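/- arXiv:2509.16468 — 2 statements merged into one kernel-verified Lean document; each statement's English description precedes it below -/
import Mathlib

section
/- Suppose ℓ(s_i∘w_1) < ℓ(w_1) and ℓ(s_i∘w_2) < ℓ(w_2). Then (1−t)·D_i^{(1)}(Z(w_1,w_2)) = σ_i(Z(s_i∘w_1, w_2)) − Z(w_1, s_i∘w_2) in K(z_1,…,z_r). -/
/-- A spin: `Sum.inl a` is the color `c_{a+1}`, `Sum.inr b` is the dolor `d_{b+1}`
(so indices are 0-based). -/
abbrev Spin (r : ℕ) := Fin r ⊕ Fin r

/-- The `k`-th boson (0-indexed) in the monochrome ordering: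
`(c_a, d_b) < (c_{a'}, d_{b'})` iff `b > b'`, or `b = b'` and `a < a'`.
A boson is recorded as the pair (color index, dolor index), 0-based. -/
def bosonOfIdx {r : ℕ} (k : Fin (r * r)) : Fin r × Fin r :=
  have hr : 0 < r := by
    rcases Nat.eq_zero_or_pos r with h | h
    · exact absurd k.2 (by simp [h])
    · exact h
  (⟨k.val % r, Nat.mod_lt _ hr⟩,
   ⟨r - 1 - k.val / r, lt_of_le_of_lt (Nat.sub_le _ _) (Nat.sub_lt hr one_pos)⟩)

/-- One admissibility step at boson `ab = (a,b)`, from spin `x` to spin `y`,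
where `m` is the multiplicity function on the top edge and `m'` on the bottom edge:
either a pass, a split, or a merge. -/
def StepOK {r : ℕ} (m m' : Fin r × Fin r → ℕ) (ab : Fin r × Fin r)
    (x y : Spin r) : Prop :=
  (y = x ∧ m' ab = m ab) ∨
  (x = Sum.inr ab.2 ∧ y = Sum.inl ab.1 ∧ m ab = m' ab + 1) ∨
  (x = Sum.inl ab.1 ∧ y = Sum.inr ab.2 ∧ m' ab = m ab + 1)

/-- Admissibility of a vertex datum: left spin `l`, top multiplicities `m`,
right spin `rr`, bottom multiplicities `m'`. -/
def AdmissibleVertex {r : ℕ} (l : Spin r) (m : Fin r × Fin r → ℕ) (rr : Spin r)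
    (m' : Fin r × Fin r → ℕ) : Prop :=
  ∃ x : Fin (r * r + 1) → Spin r, x 0 = l ∧ x (Fin.last _) = rr ∧
    ∀ k : Fin (r * r), StepOK m m' (bosonOfIdx k) (x k.castSucc) (x k.succ)

/-- The coefficient ring `ℤ[t][z_1,…,z_r]`, with `t = X none` and `z_{i+1} = X (some i)`. -/
abbrev PolyR (r : ℕ) := MvPolynomial (Option (Fin r)) ℤ

/-- The variable `t`. -/
noncomputable def tP (r : ℕ) : PolyR r := MvPolynomial.X none

/-- The variable `z_{i+1}`. -/
noncomputable def zP {r : ℕ} (i : Fin r) : PolyR r := MvPolynomial.X (some i)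

/-- Weight of a pass step at boson `ab`, where the horizontal spin is `x`,
`n` is the number of bosons on the (equal) vertical edges, and `zi` is the row parameter. -/
noncomputable def passWeight {r : ℕ} (zi : PolyR r) (n : ℕ) (ab : Fin r × Fin r)
    (x : Spin r) : PolyR r :=
  match x with
  | Sum.inl e => if e = ab.1 then zi else if e < ab.1 then tP r ^ n else 1
  | Sum.inr e =>
      if e = ab.2 then 1
      else if ab.1.val = 0 then (if e < ab.2 then tP r ^ n * zi else zi)
      else (if e < ab.2 then tP r ^ n else 1)

/-- Weight of the step at boson `ab` with top multiplicity `m`, bottom multiplicity `m'`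
and incoming horizontal spin `x`. -/
noncomputable def stepWeight {r : ℕ} (zi : PolyR r) (m m' : ℕ) (ab : Fin r × Fin r)
    (x : Spin r) : PolyR r :=
  if m = m' + 1 then ∑ j ∈ Finset.range (min m m' + 1), tP r ^ j
  else if m' = m + 1 then (1 - tP r) * zi
  else passWeight zi (min m m') ab x

/-- The (necessarily unique) next horizontal spin at a boson `ab`. -/
def nextSpin {r : ℕ} (m m' : Fin r × Fin r → ℕ) (ab : Fin r × Fin r) (x : Spin r) : Spin r :=
  if m ab = m' ab + 1 then Sum.inl ab.1
  else if m' ab = m ab + 1 then Sum.inr ab.2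
  else x

/-- The sequence of horizontal spins inside a vertex, starting from the left spin `l`.
For an admissible vertex this coincides with the unique admissibility sequence. -/
def pathSpin {r : ℕ} (m m' : Fin r × Fin r → ℕ) (l : Spin r) : ℕ → Spin r
  | 0 => l
  | k + 1 =>
      if h : k < r * r then nextSpin m m' (bosonOfIdx ⟨k, h⟩) (pathSpin m m' l k)
      else pathSpin m m' l k

/-- Boltzmann weight of an admissible vertex with row parameter `zi`, left spin `l`,
top multiplicities `m` and bottom multiplicities `m'`. -/
noncomputable def vertexWeight {r : ℕ} (zi : PolyR r) (l : Spin r)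
    (m m' : Fin r × Fin r → ℕ) : PolyR r :=
  ∏ k : Fin (r * r),
    stepWeight zi (m (bosonOfIdx k)) (m' (bosonOfIdx k)) (bosonOfIdx k)
      (pathSpin m m' l k.val)

open Classical in
/-- `W(l, m, rr, m')`: the weight of the vertex datum if admissible, and `0` otherwise. -/
noncomputable def Wvert {r : ℕ} (zi : PolyR r) (l : Spin r) (m : Fin r × Fin r → ℕ)
    (rr : Spin r) (m' : Fin r × Fin r → ℕ) : PolyR r :=
  if AdmissibleVertex l m rr m' then vertexWeight zi l m m' else 0

/-- A filling of the `r × N` grid: `m i j` are the boson multiplicities on the vertical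
edge of column `j` between rows `i` and `i+1` (row `0` is the top boundary),
and `h i j` is the horizontal spin of row `i+1` immediately to the right of column `j`
(`j = N` is the left boundary, `j = 0` the right boundary). -/
structure Filling (r N : ℕ) where
  m : Fin (r + 1) → Fin N → Fin r × Fin r → ℕ
  h : Fin r → Fin (N + 1) → Spin r

/-- A state: every vertex is admissible. -/
def Filling.IsState {r N : ℕ} (f : Filling r N) : Prop :=
  ∀ (i : Fin r) (j : Fin N),
    AdmissibleVertex (f.h i j.succ) (f.m i.castSucc j) (f.h i j.castSucc) (f.m i.succ j)

/-- Membership in the system `S(λ; w_1, w_2, w_3, w_4)`. -/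
def InSystem {r N : ℕ} (lam : Fin r → ℕ) (w1 w2 w3 w4 : Equiv.Perm (Fin r))
    (f : Filling r N) : Prop :=
  f.IsState ∧
  (∀ (j : Fin N) (a b : Fin r),
      f.m 0 j (a, b) =
        (Finset.univ.filter fun i : Fin r =>
            lam i = j.val ∧ w3⁻¹ i = a ∧ w4⁻¹ (Fin.rev i) = b).card) ∧
  (∀ (j : Fin N) (ab : Fin r × Fin r), f.m (Fin.last r) j ab = 0) ∧
  (∀ i : Fin r, f.h i 0 = Sum.inl (w1⁻¹ i)) ∧
  (∀ i : Fin r, f.h i (Fin.last N) = Sum.inr (w2⁻¹ i))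

/-- The Boltzmann weight of a state: the product of the weights of its vertices. -/
noncomputable def stateWeight {r N : ℕ} (f : Filling r N) : PolyR r :=
  ∏ i : Fin r, ∏ j : Fin N,
    vertexWeight (zP i) (f.h i j.succ) (f.m i.castSucc j) (f.m i.succ j)

open Classical in
/-- The partition function `Z(λ; w_1, w_2, w_3, w_4)`: the sum of the weights of the
states of the system (a finite sum, expressed via `finsum`). -/
noncomputable def partitionZ (r N : ℕ) (lam : Fin r → ℕ)
    (w1 w2 w3 w4 : Equiv.Perm (Fin r)) : PolyR r :=
  finsum fun f : Filling r N =>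
    if InSystem lam w1 w2 w3 w4 f then stateWeight f else 0

/-- The state `f` has a merge at vertex `(i+1, j)`. -/
def HasMergeAt {r N : ℕ} (f : Filling r N) (i : Fin r) (j : Fin N) : Prop :=
  ∃ ab : Fin r × Fin r, f.m i.castSucc j ab < f.m i.succ j ab

/-- `ℓ(w)`: the number of inversions of a permutation. -/
def invCount {r : ℕ} (w : Equiv.Perm (Fin r)) : ℕ :=
  (Finset.univ.filter fun p : Fin r × Fin r => p.1 < p.2 ∧ w p.2 < w p.1).card

/-- A transposition in `S_r`. -/
def IsTransposition {r : ℕ} (t : Equiv.Perm (Fin r)) : Prop :=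
  ∃ a b : Fin r, a ≠ b ∧ t = Equiv.swap a b

/-- Bruhat order on `S_r`. -/
def bruhatLE {r : ℕ} (u v : Equiv.Perm (Fin r)) : Prop :=
  Relation.ReflTransGen
    (fun x y => ∃ t, IsTransposition t ∧ y = x * t ∧ invCount x < invCount y) u v

/-- The field `K = ℚ(t)`. -/
abbrev Kt := RatFunc ℚ

/-- The field `K(z_1,…,z_r)` of rational functions over `K = ℚ(t)`. -/
abbrev FFld (r : ℕ) := FractionRing (MvPolynomial (Fin r) Kt)

/-- The variable `z_{i+1}` in `K(z_1,…,z_r)`. -/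
noncomputable def zF {r : ℕ} (i : Fin r) : FFld r :=
  algebraMap (MvPolynomial (Fin r) Kt) (FFld r) (MvPolynomial.X i)

/-- The element `t` in `K(z_1,…,z_r)`. -/
noncomputable def tF (r : ℕ) : FFld r :=
  algebraMap (MvPolynomial (Fin r) Kt) (FFld r) (MvPolynomial.C RatFunc.X)

/-- The canonical ring homomorphism `ℤ[t][z_1,…,z_r] → K(z_1,…,z_r)`. -/
noncomputable def toFF (r : ℕ) : PolyR r →+* FFld r :=
  MvPolynomial.eval₂Hom (Int.castRingHom (FFld r)) fun o => o.elim (tF r) zF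

/-- The K-algebra automorphism `σ` of `K(z_1,…,z_r)` exchanging `z_a` and `z_b` and
fixing the other variables. -/
noncomputable def sigmaF {r : ℕ} (a b : Fin r) : FFld r ≃+* FFld r :=
  IsFractionRing.ringEquivOfRingEquiv
    (MvPolynomial.renameEquiv Kt (Equiv.swap a b)).toRingEquiv

/-- `D^{(1)} f = (z_a - z_b)⁻¹ (z_a f - z_a σ(f))`. -/
noncomputable def DF1 {r : ℕ} (a b : Fin r) (f : FFld r) : FFld r :=
  (zF a - zF b)⁻¹ * (zF a * f - zF a * sigmaF a b f)

/-- `D^{(2)} f = (z_a - z_b)⁻¹ (z_a f - z_b σ(f))`. -/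
noncomputable def DF2 {r : ℕ} (a b : Fin r) (f : FFld r) : FFld r :=
  (zF a - zF b)⁻¹ * (zF a * f - zF b * sigmaF a b f)

/-- `D^{(3)} f = (z_a - z_b)⁻¹ (z_b f - z_a σ(f))`. -/
noncomputable def DF3 {r : ℕ} (a b : Fin r) (f : FFld r) : FFld r :=
  (zF a - zF b)⁻¹ * (zF b * f - zF a * sigmaF a b f)

/-- `D^{(4)} f = (z_a - z_b)⁻¹ (z_b f - z_b σ(f))`. -/
noncomputable def DF4 {r : ℕ} (a b : Fin r) (f : FFld r) : FFld r :=
  (zF a - zF b)⁻¹ * (zF b * f - zF b * sigmaF a b f)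


namespace YB

variable {r : ℕ}

/-- quantum integer `1 + t + ... + t^(n-1)`. -/
noncomputable def qn (r n : ℕ) : PolyR r := ∑ j ∈ Finset.range n, tP r ^ j

theorem qn_zero : qn r 0 = 0 := by simp [qn]

theorem qn_succ (n : ℕ) : qn r (n + 1) = 1 + tP r * qn r n := by
  unfold qn
  rw [Finset.sum_range_succ', Finset.mul_sum]
  simp [pow_succ', add_comm]

theorem tpow (n : ℕ) : tP r ^ n = 1 - (1 - tP r) * qn r n := by
  induction n with
  | zero => simp [qn_zero]
  | succ n ih => rw [qn_succ, pow_succ', ih]; ring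

/-- The single-boson weight matrix. -/
noncomputable def sW (z : PolyR r) (ab : Fin r × Fin r) (n n' : ℕ) :
    Matrix (Spin r) (Spin r) (PolyR r) := fun x y =>
  if y = x ∧ n' = n then passWeight z n ab x
  else if x = Sum.inr ab.2 ∧ y = Sum.inl ab.1 ∧ n = n' + 1 then qn r (n' + 1)
  else if x = Sum.inl ab.1 ∧ y = Sum.inr ab.2 ∧ n' = n + 1 then (1 - tP r) * z
  else 0

/-- The single-boson operator on functions of the multiplicity. -/
noncomputable def lOp (z : PolyR r) (ab : Fin r × Fin r) (x y : Spin r)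
    (f : ℕ → PolyR r) (n : ℕ) : PolyR r :=
  if y = x then passWeight z n ab x * f n
  else if x = Sum.inr ab.2 ∧ y = Sum.inl ab.1 then qn r n * f (n - 1)
  else if x = Sum.inl ab.1 ∧ y = Sum.inr ab.2 then (1 - tP r) * z * f (n + 1)
  else 0

theorem sW_zero (z : PolyR r) (ab : Fin r × Fin r) (n n' : ℕ) (h : n + 2 ≤ n') :
    sW z ab n n' = 0 := by
  ext1 x y
  have h1 : n' ≠ n := by omega
  have h2 : n ≠ n' + 1 := by omega
  have h3 : n' ≠ n + 1 := by omega
  simp [sW, h1, h2, h3]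

theorem sum_sW (z : PolyR r) (ab : Fin r × Fin r) (x y : Spin r) (f : ℕ → PolyR r) (n : ℕ) :
    ∑ n' ∈ Finset.range (n + 2), sW z ab n n' x y * f n' = lOp z ab x y f n := by
  unfold lOp
  by_cases h1 : y = x
  · rw [Finset.sum_eq_single n]
    · simp [sW, h1]
    · intro n' _ hn
      subst h1
      have : ∀ e : Fin r, ∀ e' : Fin r, ¬ (y = Sum.inl e ∧ y = Sum.inr e') := by
        rintro e e' ⟨h, h'⟩; simp [h] at h'
      have h2 : ¬ (y = Sum.inr ab.2 ∧ y = Sum.inl ab.1 ∧ n = n' + 1) := by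
        rintro ⟨h, h', _⟩; exact this _ _ ⟨h', h⟩
      have h3 : ¬ (y = Sum.inl ab.1 ∧ y = Sum.inr ab.2 ∧ n' = n + 1) := by
        rintro ⟨h, h', _⟩; exact this _ _ ⟨h, h'⟩
      simp only [sW]
      rw [if_neg (by tauto), if_neg h2, if_neg h3, zero_mul]
    · intro h; simp at h
  · by_cases h2 : x = Sum.inr ab.2 ∧ y = Sum.inl ab.1
    · obtain ⟨rfl, rfl⟩ := h2
      cases n with
      | zero => 
        simp only [qn_zero]
        simp [sW]
      | succ n =>
        rw [Finset.sum_eq_single n]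
        · simp [sW]
        · intro n' _ hn
          have : ¬ (n = n') := fun h => hn h.symm
          simp [sW, this]
        · intro h; simp at h; omega
    · by_cases h3 : x = Sum.inl ab.1 ∧ y = Sum.inr ab.2
      · obtain ⟨rfl, rfl⟩ := h3
        rw [Finset.sum_eq_single (n + 1)]
        · simp [sW]
        · intro n' _ hn
          simp [sW, hn]
        · intro h; simp at h
      · rw [if_neg h1, if_neg h2, if_neg h3]
        apply Finset.sum_eq_zero
        intro n' _
        simp only [sW]
        rw [if_neg (by tauto), if_neg (by tauto), if_neg (by tauto), zero_mul]

theorem sW_eq (z : PolyR r) (ab : Fin r × Fin r) (x y : Spin r) (n n' : ℕ) :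
    sW z ab n n' x y = lOp z ab x y (fun k => if k = n' then 1 else 0) n := by
  rw [← sum_sW]
  by_cases h : n' < n + 2
  · rw [Finset.sum_eq_single n']
    · simp
    · intro b _ hb; simp [hb]
    · intro h'; simp at h'; omega
  · rw [sW_zero _ _ _ _ (by omega)]; simp; intro; omega

/-- Exponent of `z₁` (plus one) in the keep weight. -/
def ke (al : ℕ) (b : ℕ) : Spin r → Spin r → ℕ
  | Sum.inl e, Sum.inl f =>
      (1 + (if f < e then 1 else 0) + (if e.val < al then 1 else 0)) -
        (if f.val < al then 1 else 0)
  | Sum.inr e, Sum.inr f =>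
      (1 + (if f < e then 1 else 0) + (if (if al = 0 then b + 1 else b) ≤ f.val then 1 else 0)) -
        (if (if al = 0 then b + 1 else b) ≤ e.val then 1 else 0)
  | Sum.inl e, Sum.inr f => if 1 ≤ al ∧ al ≤ e.val ∧ f.val ≠ b then 0 else 1
  | Sum.inr f, Sum.inl e => if 1 ≤ al ∧ al ≤ e.val ∧ f.val ≠ b then 3 else 2

noncomputable def keep (al b : ℕ) (z1 z2 : PolyR r) (x y : Spin r) : PolyR r :=
  if x = y then z1 * z2 * (z1 - tP r * z2)
  else (1 - tP r) * z1 ^ (ke al b x y) * z2 ^ (3 - ke al b x y)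

noncomputable def tw : Spin r → Spin r → PolyR r
  | Sum.inl e, Sum.inl f => if f < e then tP r else 1
  | Sum.inr e, Sum.inr f => if e < f then tP r else 1
  | Sum.inl _, Sum.inr _ => tP r
  | Sum.inr _, Sum.inl _ => 1

noncomputable def swp (z1 z2 : PolyR r) (x y : Spin r) : PolyR r :=
  if x = y then 0 else z1 * z2 * (z1 - z2) * tw x y

end YB


namespace YB

variable {r : ℕ}

/-- The statement of the one-site Yang-Baxter equation, for fixed spins. -/
def YS (a b : Fin r) (z1 z2 : PolyR r) (x1 x2 y1 y2 : Spin r) (f : ℕ → PolyR r) (n : ℕ) : Prop :=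
  keep a b z1 z2 x1 x2 * lOp z1 (a, b) x1 y1 (lOp z2 (a, b) x2 y2 f) n
    + swp z1 z2 x1 x2 * lOp z1 (a, b) x2 y1 (lOp z2 (a, b) x1 y2 f) n
  = lOp z2 (a, b) x1 y1 (lOp z1 (a, b) x2 y2 f) n * keep (a + 1) b z1 z2 y1 y2
    + lOp z2 (a, b) x1 y2 (lOp z1 (a, b) x2 y1 f) n * swp z1 z2 y2 y1

section
variable (a b : Fin r) (z z1 z2 : PolyR r) (f : ℕ → PolyR r) (n : ℕ)

theorem lOp_AA : lOp z (a, b) (Sum.inl a) (Sum.inl a) f n = z * f n := by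
  simp [lOp, passWeight]

theorem lOp_BB : lOp z (a, b) (Sum.inr b) (Sum.inr b) f n = f n := by
  simp [lOp, passWeight]

theorem lOp_AB : lOp z (a, b) (Sum.inl a) (Sum.inr b) f n = (1 - tP r) * z * f (n + 1) := by
  simp [lOp]

theorem lOp_BA : lOp z (a, b) (Sum.inr b) (Sum.inl a) f n = qn r n * f (n - 1) := by
  simp [lOp]

theorem lOp_P (x : Spin r) : lOp z (a, b) x x f n = passWeight z n (a, b) x * f n := by
  simp [lOp]

theorem lOp_P0 (x y : Spin r) (hA : x ≠ Sum.inl a) (hB : x ≠ Sum.inr b) (h : y ≠ x) :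
    lOp z (a, b) x y f n = 0 := by
  simp [lOp, h, hA, hB]

theorem lOp_P0' (x y : Spin r) (hA : y ≠ Sum.inl a) (hB : y ≠ Sum.inr b) (h : y ≠ x) :
    lOp z (a, b) x y f n = 0 := by
  simp [lOp, h, hA, hB]

theorem qf (g : ℕ → PolyR r) : qn r n * g (n - 1 + 1) = qn r n * g n := by
  cases n <;> simp [qn_zero]

theorem qq : qn r n * qn r (n - 1 + 1) = qn r n * qn r n := by
  cases n <;> simp [qn_zero]

theorem qf2 (c : PolyR r) (g : ℕ → PolyR r) : qn r n * (c * g (n - 1 + 1)) = c * (qn r n * g n) := by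
  rw [← qf]; ring

/-- Active block: all four spins in `{c_a, d_b}`. -/
theorem ybe_AB (x1 x2 y1 y2 : Spin r)
    (h1 : x1 = Sum.inl a ∨ x1 = Sum.inr b) (h2 : x2 = Sum.inl a ∨ x2 = Sum.inr b)
    (h3 : y1 = Sum.inl a ∨ y1 = Sum.inr b) (h4 : y2 = Sum.inl a ∨ y2 = Sum.inr b) :
    YS a b z1 z2 x1 x2 y1 y2 f n := by
  rcases h1 with rfl | rfl <;> rcases h2 with rfl | rfl <;> rcases h3 with rfl | rfl <;>
    rcases h4 with rfl | rfl <;>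
    simp only [YS, lOp_AA, lOp_BB, lOp_AB, lOp_BA, keep, swp, ke, tw, if_true, reduceCtorEq,
      if_false, ne_eq, not_true_eq_false, and_false, qn_succ, Nat.add_sub_cancel, qf2] <;>
    ring1

theorem passive_cases (x : Spin r) (hA : x ≠ Sum.inl a) (hB : x ≠ Sum.inr b) :
    (∃ e : Fin r, x = Sum.inl e ∧ e < a) ∨ (∃ e : Fin r, x = Sum.inl e ∧ a < e) ∨
    (∃ e : Fin r, x = Sum.inr e ∧ e < b) ∨ (∃ e : Fin r, x = Sum.inr e ∧ b < e) := by
  rcases x with e | e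
  · rcases lt_trichotomy e a with h | h | h
    · exact Or.inl ⟨e, rfl, h⟩
    · simp [h] at hA
    · exact Or.inr (Or.inl ⟨e, rfl, h⟩)
  · rcases lt_trichotomy e b with h | h | h
    · exact Or.inr (Or.inr (Or.inl ⟨e, rfl, h⟩))
    · simp [h] at hB
    · exact Or.inr (Or.inr (Or.inr ⟨e, rfl, h⟩))

/-- power of `t` per boson in a pass. -/
def te : Spin r → ℕ
  | Sum.inl e => if e < a then 1 else 0
  | Sum.inr e => if e < b then 1 else 0

/-- power of `z` in a pass. -/
def ze : Spin r → ℕ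
  | Sum.inl e => if e = a then 1 else 0
  | Sum.inr e => if e = b then 0 else if a.val = 0 then 1 else 0

theorem teA : te a b (Sum.inl a) = 0 := by simp [te]
theorem teB : te a b (Sum.inr b) = 0 := by simp [te]
theorem zeA : ze a b (Sum.inl a) = 1 := by simp [ze]
theorem zeB : ze a b (Sum.inr b) = 0 := by simp [ze]

theorem pass_eq (x : Spin r) :
    passWeight z n (a, b) x = tP r ^ (te a b x * n) * z ^ (ze a b x) := by
  rcases x with e | e
  · simp only [passWeight, te, ze]
    split_ifs <;> first | (exfalso; omega) | simp
  · simp only [passWeight, te, ze]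
    split_ifs <;> first | (exfalso; omega) | simp

theorem ke_le (al b : ℕ) (x y : Spin r) : ke al b x y ≤ 3 := by
  rcases x with e | e <;> rcases y with g | g <;> simp only [ke] <;> split_ifs <;> omega

theorem ke_step (x y : Spin r) (hxy : x ≠ y) 
    (h : ¬ (x = Sum.inl a ∧ y = Sum.inr b)) (h' : ¬ (y = Sum.inl a ∧ x = Sum.inr b)) :
    ke a b x y + ze a b x = ke (a + 1) b x y + ze a b y := by
  rcases x with e | e <;> rcases y with g | g <;> simp only [ke, ze] <;>
    simp only [ne_eq, Sum.inl.injEq, Sum.inr.injEq, reduceCtorEq, false_and, and_false,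
      not_false_eq_true, Fin.ext_iff, Fin.lt_def] at hxy h h' ⊢ <;>
    split_ifs <;> first | contradiction | omega

theorem keep_step (x y : Spin r) (h : ¬ (x = Sum.inl a ∧ y = Sum.inr b))
    (h' : ¬ (y = Sum.inl a ∧ x = Sum.inr b)) :
    keep a b z1 z2 x y * (z1 ^ ze a b x * z2 ^ ze a b y) =
      keep (a + 1) b z1 z2 x y * (z2 ^ ze a b x * z1 ^ ze a b y) := by
  unfold keep
  split_ifs with hxy
  · subst hxy; ring
  · have h1 := ke_step a b x y hxy h h'
    have h2 := ke_le a b x y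
    have h3 := ke_le (a + 1) b x y
    have h4 : (3 - ke a b x y) + ze a b y = (3 - ke (a + 1) b x y) + ze a b x := by omega
    calc _ = (1 - tP r) * z1 ^ (ke a b x y + ze a b x) * z2 ^ ((3 - ke a b x y) + ze a b y) := by ring
      _ = _ := by rw [h1, h4]; ring

theorem ybe_PP (x1 x2 y1 y2 : Spin r)
    (h1 : x1 ≠ Sum.inl a ∧ x1 ≠ Sum.inr b) (h2 : x2 ≠ Sum.inl a ∧ x2 ≠ Sum.inr b) :
    YS a b z1 z2 x1 x2 y1 y2 f n := by
  have L : ∀ z x y g n, (x = x1 ∨ x = x2) → y ≠ x → lOp z (a, b) x y g n = 0 := by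
    rintro z x y g n (rfl | rfl) h
    · exact lOp_P0 _ _ _ _ _ _ _ h1.1 h1.2 h
    · exact lOp_P0 _ _ _ _ _ _ _ h2.1 h2.2 h
  have L2 : ∀ z z' x y y' g n, (x = x1 ∨ x = x2) → ∀ x', (x' = x1 ∨ x' = x2) → (y ≠ x ∨ y' ≠ x') →
      lOp z (a, b) x y (lOp z' (a, b) x' y' g) n = 0 := by
    rintro z z' x y y' g n h x' h' hy
    by_cases hh : y = x
    · subst hh
      have : y' ≠ x' := by simpa using hy
      rw [lOp_P, L _ _ _ _ _ h' this, mul_zero]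
    · exact L _ _ _ _ _ h hh
  unfold YS
  by_cases hy : y1 = x1 ∧ y2 = x2
  · obtain ⟨rfl, rfl⟩ := hy
    by_cases hx : y1 = y2
    · subst hx
      simp only [lOp_P, pass_eq, keep, swp, if_true]; ring
    · rw [L2 z1 z2 y2 y1 y2 f n (by simp) y1 (by simp) (Or.inl hx),
        L2 z2 z1 y1 y2 y1 f n (by simp) y2 (by simp) (Or.inl (Ne.symm hx))]
      simp only [lOp_P, pass_eq]
      have := keep_step a b z1 z2 y1 y2 (by tauto) (by tauto)
      linear_combination (tP r ^ (te a b y1 * n) * tP r ^ (te a b y2 * n) * f n) * this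
  · by_cases hy' : y1 = x2 ∧ y2 = x1
    · obtain ⟨rfl, rfl⟩ := hy'
      have hx : y2 ≠ y1 := by
        rintro rfl; simp at hy
      rw [L2 z1 z2 y2 y1 y2 f n (by simp) y1 (by simp) (Or.inl (Ne.symm hx)),
        L2 z2 z1 y2 y1 y2 f n (by simp) y1 (by simp) (Or.inl (Ne.symm hx))]
      simp only [lOp_P, pass_eq]
      ring
    · rw [L2 z1 z2 x1 y1 y2 f n (by simp) x2 (by simp) (by tauto),
        L2 z1 z2 x2 y1 y2 f n (by simp) x1 (by simp) (by tauto),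
        L2 z2 z1 x1 y1 y2 f n (by simp) x2 (by simp) (by tauto),
        L2 z2 z1 x1 y2 y1 f n (by simp) x2 (by simp) (by tauto)]
      ring

/-- auxiliary: transfer of keep weights along exponent identities. -/
theorem keep_aux (al al' bb : ℕ) (x y x' y' : Spin r) (p q p' q' : ℕ) (h : x ≠ y) (h' : x' ≠ y')
    (e1 : ke al bb x y + p = ke al' bb x' y' + p') (e2 : p + q = p' + q') :
    keep al bb z1 z2 x y * (z1 ^ p * z2 ^ q) = keep al' bb z1 z2 x' y' * (z1 ^ p' * z2 ^ q') := by
  have h2 := ke_le al bb x y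
  have h3 := ke_le al' bb x' y'
  unfold keep
  rw [if_neg h, if_neg h']
  have h4 : (3 - ke al bb x y) + q = (3 - ke al' bb x' y') + q' := by omega
  calc _ = (1 - tP r) * z1 ^ (ke al bb x y + p) * z2 ^ ((3 - ke al bb x y) + q) := by ring
    _ = _ := by rw [e1, h4]; ring

theorem ke_AP (P : Spin r) (h : P ≠ Sum.inl a ∧ P ≠ Sum.inr b) :
    ke a b (Sum.inl a) P + 1 = ke (a + 1) b (Sum.inr b) P + ze a b P ∧
    ke a b (Sum.inr b) P = ke (a + 1) b (Sum.inl a) P + ze a b P ∧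
    ke a b P (Sum.inl a) + ze a b P = ke (a + 1) b P (Sum.inr b) + 1 ∧
    ke a b P (Sum.inr b) + ze a b P = ke (a + 1) b P (Sum.inl a) ∧
    ke a b (Sum.inl a) P + 1 = ke (a + 1) b (Sum.inl a) P + ze a b P ∧
    ke a b (Sum.inr b) P = ke (a + 1) b (Sum.inr b) P + ze a b P ∧
    ke a b P (Sum.inl a) + ze a b P = ke (a + 1) b P (Sum.inl a) + 1 ∧
    ke a b P (Sum.inr b) + ze a b P = ke (a + 1) b P (Sum.inr b) := by
  rcases P with e | e <;> simp only [ke, ze] <;>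
    simp only [ne_eq, Sum.inl.injEq, Sum.inr.injEq, reduceCtorEq, and_true, true_and, not_true_eq_false,
      if_false, and_false, not_false_eq_true, lt_irrefl, Fin.ext_iff, Fin.lt_def] at h ⊢ <;>
    refine ⟨?_, ?_, ?_, ?_, ?_, ?_, ?_, ?_⟩ <;>
    split_ifs <;> first | contradiction | omega

theorem tw_AP (P : Spin r) (h : P ≠ Sum.inl a ∧ P ≠ Sum.inr b) :
    tw (Sum.inl a) P = tP r ^ te a b P * tw (Sum.inr b) P ∧
    tw P (Sum.inr b) = tP r ^ te a b P * tw P (Sum.inl a) := by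
  rcases passive_cases a b P h.1 h.2 with ⟨e, rfl, he⟩ | ⟨e, rfl, he⟩ | ⟨e, rfl, he⟩ | ⟨e, rfl, he⟩ <;>
    simp [tw, te, he, not_lt.2 he.le]

theorem swp_AP (P : Spin r) (h : P ≠ Sum.inl a ∧ P ≠ Sum.inr b) :
    swp z1 z2 (Sum.inl a) P = tP r ^ te a b P * swp z1 z2 (Sum.inr b) P ∧
    swp z1 z2 P (Sum.inr b) = tP r ^ te a b P * swp z1 z2 P (Sum.inl a) := by
  unfold swp
  rw [if_neg h.1.symm, if_neg h.2.symm, if_neg h.1, if_neg h.2, (tw_AP a b P h).1, (tw_AP a b P h).2]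
  constructor <;> ring

theorem qt (c : PolyR r) (k : ℕ) : qn r n * (tP r ^ (k * (n - 1)) * c) * tP r ^ k =
    qn r n * tP r ^ (k * n) * c := by
  cases n with
  | zero => simp [qn_zero]
  | succ n => simp only [Nat.add_sub_cancel]; ring

theorem ybe_PQ (P Q y1 y2 : Spin r)
    (h1 : P ≠ Sum.inl a ∧ P ≠ Sum.inr b) (h2 : Q = Sum.inl a ∨ Q = Sum.inr b) :
    YS a b z1 z2 P Q y1 y2 f n := by
  have hPQ : P ≠ Q := by rcases h2 with rfl | rfl <;> tauto
  have L : ∀ z y g n, y ≠ P → lOp z (a, b) P y g n = 0 := fun z y g n h =>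
    lOp_P0 _ _ _ _ _ _ _ h1.1 h1.2 h
  have L' : ∀ z g n, lOp z (a, b) Q P g n = 0 := fun z g n =>
    lOp_P0' _ _ _ _ _ _ _ h1.1 h1.2 hPQ
  have L3 : ∀ z y g n, ¬ (y = Sum.inl a ∨ y = Sum.inr b) → lOp z (a, b) Q y g n = 0 := by
    intro z y g n h
    apply lOp_P0' _ _ _ _ _ _ _ (by tauto) (by tauto)
    rintro rfl; tauto
  have hz : ∀ z y n, lOp z (a, b) Q y (fun _ => 0) n = 0 := by
    intro z y n; simp [lOp]
  have hz' : ∀ z y g z' y' n, y ≠ P → lOp z (a, b) Q y' (lOp z' (a, b) P y g) n = 0 := by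
    intro z y g z' y' n h
    rw [show lOp z' (a, b) P y g = fun _ => 0 from funext fun n => L _ _ _ _ h, hz]
  have k := ke_AP a b P h1
  have s := swp_AP a b z1 z2 P h1
  unfold YS
  by_cases hy : y1 = P
  · subst hy
    by_cases hy2 : y2 = Sum.inl a ∨ y2 = Sum.inr b
    · have hyy : y2 ≠ y1 := by rintro rfl; tauto
      rw [L', L z2 y2 _ _ hyy]
      rcases h2 with rfl | rfl <;> rcases hy2 with rfl | rfl
      · have := keep_aux z1 z2 a (a + 1) b y1 (Sum.inl a) y1 (Sum.inl a) (ze a b y1) 1 1 (ze a b y1)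
          h1.1 h1.1 k.2.2.2.2.2.2.1 (by omega)
        simp only [lOp_P, pass_eq, teA, zeA, teB, zeB]
        linear_combination tP r ^ (te a b y1 * n) * f n * this
      · have := keep_aux z1 z2 a (a + 1) b y1 (Sum.inl a) y1 (Sum.inr b) (ze a b y1) 1 1 (ze a b y1)
          h1.1 h1.2 k.2.2.1 (by omega)
        simp only [lOp_P, pass_eq, lOp_AB]
        linear_combination tP r ^ (te a b y1 * n) * (1 - tP r) * f (n + 1) * this
      · have := keep_aux z1 z2 a (a + 1) b y1 (Sum.inr b) y1 (Sum.inl a) (ze a b y1) 0 0 (ze a b y1)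
          h1.2 h1.1 k.2.2.2.1 (by omega)
        simp only [lOp_P, pass_eq, lOp_BA]
        linear_combination tP r ^ (te a b y1 * n) * qn r n * f (n - 1) * this
      · have := keep_aux z1 z2 a (a + 1) b y1 (Sum.inr b) y1 (Sum.inr b) (ze a b y1) 0 0 (ze a b y1)
          h1.2 h1.2 k.2.2.2.2.2.2.2 (by omega)
        simp only [lOp_P, pass_eq, teA, zeA, teB, zeB]
        linear_combination tP r ^ (te a b y1 * n) * f n * this
    · rw [L']
      simp only [lOp_P]
      rw [L3 _ _ _ _ hy2, L3 _ _ _ _ hy2]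
      by_cases hyy : y2 = y1
      · subst hyy; simp [lOp_P, L']
      · rw [L _ _ _ _ hyy]; simp
  · by_cases hy2 : y2 = P
    · subst hy2
      rw [L z1 _ _ _ hy, L z2 _ _ _ hy]
      by_cases hy1 : y1 = Sum.inl a ∨ y1 = Sum.inr b
      · rcases h2 with rfl | rfl <;> rcases hy1 with rfl | rfl
        · simp only [lOp_P, pass_eq, teA, zeA, teB, zeB]
          ring
        · simp only [lOp_P, pass_eq, lOp_AB, s.2]
          ring
        · simp only [lOp_P, pass_eq, lOp_BA, s.2]
          linear_combination swp z1 z2 y2 (Sum.inl a) * qt n (z2 ^ ze a b y2 * f (n - 1)) (te a b y2)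
        · simp only [lOp_P, pass_eq, teA, zeA, teB, zeB]
          ring
      · rw [L3 _ _ _ _ hy1]
        simp only [lOp_P]
        rw [L3 _ _ _ _ hy1]; simp
    · rw [L z1 _ _ _ hy, L z2 _ _ _ hy, L z2 _ _ _ hy2, hz' _ _ _ _ _ _ hy2]
      ring

theorem ybe_QP (P Q y1 y2 : Spin r)
    (h1 : P ≠ Sum.inl a ∧ P ≠ Sum.inr b) (h2 : Q = Sum.inl a ∨ Q = Sum.inr b) :
    YS a b z1 z2 Q P y1 y2 f n := by
  have hPQ : P ≠ Q := by rcases h2 with rfl | rfl <;> tauto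
  have L : ∀ z y g n, y ≠ P → lOp z (a, b) P y g n = 0 := fun z y g n h =>
    lOp_P0 _ _ _ _ _ _ _ h1.1 h1.2 h
  have L' : ∀ z g n, lOp z (a, b) Q P g n = 0 := fun z g n =>
    lOp_P0' _ _ _ _ _ _ _ h1.1 h1.2 hPQ
  have L3 : ∀ z y g n, ¬ (y = Sum.inl a ∨ y = Sum.inr b) → lOp z (a, b) Q y g n = 0 := by
    intro z y g n h
    apply lOp_P0' _ _ _ _ _ _ _ (by tauto) (by tauto)
    rintro rfl; tauto
  have hz : ∀ z y n, lOp z (a, b) Q y (fun _ => 0) n = 0 := by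
    intro z y n; simp [lOp]
  have hz' : ∀ z y g z' y' n, y ≠ P → lOp z (a, b) Q y' (lOp z' (a, b) P y g) n = 0 := by
    intro z y g z' y' n h
    rw [show lOp z' (a, b) P y g = fun _ => 0 from funext fun n => L _ _ _ _ h, hz]
  have k := ke_AP a b P h1
  have s := swp_AP a b z1 z2 P h1
  unfold YS
  by_cases hy : y2 = P
  · subst hy
    by_cases hy1 : y1 = Sum.inl a ∨ y1 = Sum.inr b
    · have hyy : y1 ≠ y2 := by rintro rfl; tauto
      rw [L', L z1 y1 _ _ hyy]
      rcases h2 with rfl | rfl <;> rcases hy1 with rfl | rfl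
      · have := keep_aux z1 z2 a (a + 1) b (Sum.inl a) y2 (Sum.inl a) y2 1 (ze a b y2) (ze a b y2) 1
          h1.1.symm h1.1.symm k.2.2.2.2.1 (by omega)
        simp only [lOp_P, pass_eq, teA, zeA, teB, zeB]
        linear_combination tP r ^ (te a b y2 * n) * f n * this
      · have := keep_aux z1 z2 a (a + 1) b (Sum.inl a) y2 (Sum.inr b) y2 1 (ze a b y2) (ze a b y2) 1
          h1.1.symm h1.2.symm k.1 (by omega)
        simp only [lOp_P, pass_eq, lOp_AB]
        linear_combination tP r ^ (te a b y2 * (n + 1)) * (1 - tP r) * f (n + 1) * this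
      · have := keep_aux z1 z2 a (a + 1) b (Sum.inr b) y2 (Sum.inl a) y2 0 (ze a b y2) (ze a b y2) 0
          h1.2.symm h1.1.symm k.2.1 (by omega)
        simp only [lOp_P, pass_eq, lOp_BA]
        linear_combination tP r ^ (te a b y2 * (n - 1)) * qn r n * f (n - 1) * this
      · have := keep_aux z1 z2 a (a + 1) b (Sum.inr b) y2 (Sum.inr b) y2 0 (ze a b y2) (ze a b y2) 0
          h1.2.symm h1.2.symm k.2.2.2.2.2.1 (by omega)
        simp only [lOp_P, pass_eq, teA, zeA, teB, zeB]
        linear_combination tP r ^ (te a b y2 * n) * f n * this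
    · rw [L', L3 _ _ _ _ hy1, L3 _ _ _ _ hy1]
      by_cases hyy : y1 = y2
      · subst hyy; simp [lOp_P, L']
      · rw [L _ _ _ _ hyy]; simp
  · by_cases hy1 : y1 = P
    · subst hy1
      rw [L', L']
      by_cases hy1 : y2 = Sum.inl a ∨ y2 = Sum.inr b
      · rcases h2 with rfl | rfl <;> rcases hy1 with rfl | rfl
        · simp only [lOp_P, pass_eq, teA, zeA, teB, zeB]
          ring
        · simp only [lOp_P, pass_eq, lOp_AB, s.1]
          ring
        · simp only [lOp_P, pass_eq, lOp_BA, s.1]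
          linear_combination (-swp z1 z2 (Sum.inr b) y1) * qt n (z1 ^ ze a b y1 * f (n - 1)) (te a b y1)
        · simp only [lOp_P, pass_eq, teA, zeA, teB, zeB]
          ring
      · rw [L3 _ _ _ _ hy1]
        simp only [lOp_P]
        rw [L3 _ _ _ _ hy1]; simp
    · rw [hz' _ _ _ _ _ _ hy, hz' _ _ _ _ _ _ hy, L _ _ _ _ hy1, hz' _ _ _ _ _ _ hy1]
      ring

theorem ybe_site (x1 x2 y1 y2 : Spin r) : YS a b z1 z2 x1 x2 y1 y2 f n := by
  by_cases h1 : x1 = Sum.inl a ∨ x1 = Sum.inr b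
  · by_cases h2 : x2 = Sum.inl a ∨ x2 = Sum.inr b
    · have L3 : ∀ x z y g n, (x = Sum.inl a ∨ x = Sum.inr b) → ¬ (y = Sum.inl a ∨ y = Sum.inr b) →
          lOp z (a, b) x y g n = 0 := by
        intro x z y g n hx h
        apply lOp_P0' _ _ _ _ _ _ _ (by tauto) (by tauto)
        rintro rfl; tauto
      have hz' : ∀ x x' z y g z' y' n, (x = Sum.inl a ∨ x = Sum.inr b) →
          ¬ (y = Sum.inl a ∨ y = Sum.inr b) →
          lOp z (a, b) x' y' (lOp z' (a, b) x y g) n = 0 := by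
        intro x x' z y g z' y' n hx h
        rw [show lOp z' (a, b) x y g = fun _ => 0 from funext fun n => L3 _ _ _ _ _ hx h]
        simp [lOp]
      by_cases h3 : y1 = Sum.inl a ∨ y1 = Sum.inr b
      · by_cases h4 : y2 = Sum.inl a ∨ y2 = Sum.inr b
        · exact ybe_AB a b z1 z2 f n x1 x2 y1 y2 h1 h2 h3 h4
        · unfold YS
          rw [hz' x2 x1 _ _ _ _ _ _ h2 h4, hz' x1 x2 _ _ _ _ _ _ h1 h4, hz' x2 x1 _ _ _ _ _ _ h2 h4,
            L3 x1 _ _ _ _ h1 h4]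
          ring
      · unfold YS
        rw [L3 x1 _ _ _ _ h1 h3, L3 x2 _ _ _ _ h2 h3, L3 x1 _ _ _ _ h1 h3, hz' x2 x1 _ _ _ _ _ _ h2 h3]
        ring
    · exact ybe_QP a b z1 z2 f n x2 x1 y1 y2 (by tauto) h1
  · by_cases h2 : x2 = Sum.inl a ∨ x2 = Sum.inr b
    · exact ybe_PQ a b z1 z2 f n x1 x2 y1 y2 (by tauto) h2
    · exact ybe_PP a b z1 z2 f n x1 x2 y1 y2 (by tauto) (by tauto)

end

end YB


namespace YB

variable {r : ℕ}

open scoped Kronecker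

/-! ### Generic list-product lemmas -/

theorem sum_pi_prod {R X : Type*} [Semiring R] [Fintype X] (n : ℕ) (A : Fin n → X → R) :
    ∑ f : Fin n → X, (List.ofFn fun i => A i (f i)).prod
      = (List.ofFn fun i => ∑ x, A i x).prod := by
  induction n with
  | zero => simp
  | succ n ih =>
    rw [← (Fin.consEquiv (fun _ => X)).sum_comp, Fintype.sum_prod_type]
    simp only [List.ofFn_succ, List.prod_cons, Fin.consEquiv_apply, Fin.cons_zero, Fin.cons_succ]
    rw [← ih, Finset.sum_mul]
    simp only [Finset.mul_sum]

theorem train {R : Type*} [Monoid R] (n : ℕ) (Q : ℕ → R) (U V : Fin n → R)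
    (h : ∀ k : Fin n, Q k * U k = V k * Q (k + 1)) :
    Q 0 * (List.ofFn U).prod = (List.ofFn V).prod * Q n := by
  induction n generalizing Q with
  | zero => simp
  | succ n ih =>
    simp only [List.ofFn_succ, List.prod_cons]
    have h0 := h 0
    simp only [Fin.val_zero, zero_add] at h0
    have := ih (fun k => Q (k + 1)) (fun i => U i.succ) (fun i => V i.succ)
      (fun k => by simpa using h k.succ)
    simp only [zero_add] at this
    rw [← mul_assoc, h0, mul_assoc, this, mul_assoc]

theorem kron_prod {S R : Type*} [Fintype S] [DecidableEq S] [CommSemiring R] (n : ℕ)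
    (A B : Fin n → Matrix S S R) :
    (List.ofFn fun i => (A i) ⊗ₖ (B i)).prod = (List.ofFn A).prod ⊗ₖ (List.ofFn B).prod := by
  induction n with
  | zero => simp
  | succ n ih =>
    simp only [List.ofFn_succ, List.prod_cons]
    rw [ih, Matrix.mul_kronecker_mul]

theorem path_prod {S R : Type*} [Fintype S] [DecidableEq S] [CommSemiring R] (n : ℕ)
    (A : Fin n → Matrix S S R) (x y : S) :
    (List.ofFn A).prod x y = ∑ h : Fin (n + 1) → S,
      if h 0 = x ∧ h (Fin.last n) = y then ∏ j, A j (h j.castSucc) (h j.succ) else 0 := by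
  induction n generalizing x with
  | zero =>
    rw [← (Fin.consEquiv (fun _ => S)).sum_comp, Fintype.sum_prod_type]
    simp only [List.ofFn_zero, List.prod_nil, Matrix.one_apply, Fin.consEquiv_apply,
      Fin.cons_zero, Finset.univ_eq_empty, Finset.prod_empty, Fin.last_zero, Finset.univ_unique,
      Finset.sum_singleton]
    rw [Finset.sum_eq_single x]
    · simp
    · intro b _ hb; rw [if_neg]; rintro ⟨h, _⟩; exact hb h
    · simp
  | succ n ih =>
    rw [← (Fin.consEquiv (fun _ => S)).sum_comp, Fintype.sum_prod_type]
    simp only [List.ofFn_succ, List.prod_cons, Matrix.mul_apply, ih, Fin.consEquiv_apply,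
      Fin.cons_zero, Fin.prod_univ_succ, Fin.castSucc_zero, Fin.cons_succ, ← Fin.succ_last,
      ← Fin.succ_castSucc]
    symm
    rw [Finset.sum_eq_single x]
    · simp only [true_and, Finset.mul_sum]
      rw [Finset.sum_comm]
      apply Finset.sum_congr rfl
      intro h _
      rw [Finset.sum_eq_single (h 0)]
      · simp
      · intro b _ hb; rw [if_neg, mul_zero]; rintro ⟨h1, _⟩; exact hb h1.symm
      · simp
    · intro b _ hb; apply Finset.sum_eq_zero; intro h _; rw [if_neg]; rintro ⟨h1, _⟩; exact hb h1
    · simp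

/-! ### Stages -/

theorem keep_wrap (b b' : ℕ) (hr : 0 < r) (h : (b' + 1 = b) ∨ (b = 0 ∧ b' + 1 = r)) (z1 z2 : PolyR r)
    (x y : Spin r) : keep r b z1 z2 x y = keep 0 b' z1 z2 x y := by
  have : ke r b x y = ke 0 b' x y := by
    rcases x with e | e <;> rcases y with f | f <;> have := e.2 <;> have := f.2 <;>
      simp [ke] <;> first | omega | (split_ifs <;> omega)
  unfold keep; rw [this]

noncomputable def RM (al b : ℕ) (z1 z2 : PolyR r) :
    Matrix (Spin r × Spin r) (Spin r × Spin r) (PolyR r) := fun x y =>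
  (if y.1 = x.1 ∧ y.2 = x.2 then keep al b z1 z2 x.1 x.2 else 0) +
  (if y.1 = x.2 ∧ y.2 = x.1 then swp z1 z2 x.1 x.2 else 0)

noncomputable def uM (B : ℕ) (z1 z2 : PolyR r) (ab : Fin r × Fin r) (n n'' : ℕ) :
    Matrix (Spin r × Spin r) (Spin r × Spin r) (PolyR r) :=
  ∑ n' : Fin B, (sW z1 ab n n') ⊗ₖ (sW z2 ab n' n'')

theorem uM_apply (B : ℕ) (z1 z2 : PolyR r) (ab : Fin r × Fin r) (n n'' : ℕ) (hB : n + 2 ≤ B)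
    (x y : Spin r × Spin r) :
    uM B z1 z2 ab n n'' x y =
      lOp z1 ab x.1 y.1 (lOp z2 ab x.2 y.2 (fun k => if k = n'' then 1 else 0)) n := by
  rw [← sum_sW]
  simp only [uM, Matrix.sum_apply, Matrix.kroneckerMap_apply]
  rw [Fin.sum_univ_eq_sum_range (fun n' => sW z1 ab n n' x.1 y.1 * sW z2 ab n' n'' x.2 y.2)]
  symm
  simp only [← sW_eq]
  apply Finset.sum_subset
  · intro k; simp; omega
  · intro k _ hk; simp at hk; rw [sW_zero _ _ _ _ (by omega)]; simp

theorem RM_mul (al b : ℕ) (z1 z2 : PolyR r) (A : Matrix (Spin r × Spin r) (Spin r × Spin r) (PolyR r))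
    (x y : Spin r × Spin r) : (RM al b z1 z2 * A) x y =
      keep al b z1 z2 x.1 x.2 * A x y + swp z1 z2 x.1 x.2 * A (x.2, x.1) y := by
  rw [Matrix.mul_apply]
  simp only [RM, add_mul, Finset.sum_add_distrib, ite_mul, zero_mul]
  congr 1
  · rw [Finset.sum_eq_single x]
    · simp
    · rintro c _ hc; rw [if_neg]; rintro ⟨h1, h2⟩; exact hc (Prod.ext h1 h2)
    · simp
  · rw [Finset.sum_eq_single (x.2, x.1)]
    · simp
    · rintro c _ hc; rw [if_neg]; rintro ⟨h1, h2⟩; exact hc (Prod.ext h1 h2)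
    · simp

theorem mul_RM (al b : ℕ) (z1 z2 : PolyR r) (A : Matrix (Spin r × Spin r) (Spin r × Spin r) (PolyR r))
    (x y : Spin r × Spin r) : (A * RM al b z1 z2) x y =
      A x y * keep al b z1 z2 y.1 y.2 + A x (y.2, y.1) * swp z1 z2 y.2 y.1 := by
  rw [Matrix.mul_apply]
  simp only [RM, mul_add, Finset.sum_add_distrib, mul_ite, mul_zero]
  congr 1
  · rw [Finset.sum_eq_single y]
    · simp
    · rintro c _ hc; rw [if_neg]; rintro ⟨h1, h2⟩; exact hc (Prod.ext h1.symm h2.symm)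
    · simp
  · rw [Finset.sum_eq_single (y.2, y.1)]
    · simp
    · rintro c _ hc; rw [if_neg]; rintro ⟨h1, h2⟩; exact hc (Prod.ext h2.symm h1.symm)
    · simp

theorem RM_site (B : ℕ) (z1 z2 : PolyR r) (ab : Fin r × Fin r) (n n'' : ℕ) (hB : n + 2 ≤ B) :
    RM ab.1 ab.2 z1 z2 * uM B z1 z2 ab n n'' = uM B z2 z1 ab n n'' * RM (ab.1 + 1) ab.2 z1 z2 := by
  ext1 x y
  rw [RM_mul, mul_RM]
  simp only [uM_apply B _ _ _ _ _ hB]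
  exact ybe_site ab.1 ab.2 z1 z2 _ n x.1 x.2 y.1 y.2

theorem RM_wrap (b b' : ℕ) (hr : 0 < r) (h : (b' + 1 = b) ∨ (b = 0 ∧ b' + 1 = r)) (z1 z2 : PolyR r) :
    RM r b z1 z2 = RM 0 b' z1 z2 := by
  ext1 x y
  simp only [RM, keep_wrap b b' hr h]

/-- R-matrix at stage `k`. -/
noncomputable def Rk (z1 z2 : PolyR r) (k : ℕ) :
    Matrix (Spin r × Spin r) (Spin r × Spin r) (PolyR r) :=
  RM (k % r) (if k = r * r then r - 1 else r - 1 - k / r) z1 z2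

theorem Rk_step (B : ℕ) (z1 z2 : PolyR r) (k : Fin (r * r)) (n n'' : ℕ) (hB : n + 2 ≤ B) :
    Rk z1 z2 k * uM B z1 z2 (bosonOfIdx k) n n'' =
      uM B z2 z1 (bosonOfIdx k) n n'' * Rk z1 z2 (k + 1) := by
  have hr : 0 < r := by
    rcases Nat.eq_zero_or_pos r with h | h
    · exact absurd k.2 (by simp [h])
    · exact h
  have hk := k.2
  have h := RM_site B z1 z2 (bosonOfIdx k) n n'' hB
  have e1 : ((bosonOfIdx k).1 : ℕ) = k % r := rfl
  have e2 : ((bosonOfIdx k).2 : ℕ) = r - 1 - k / r := rfl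
  rw [e1, e2] at h
  have hR : Rk z1 z2 k = RM (k % r) (r - 1 - k / r) z1 z2 := by
    unfold Rk; rw [if_neg (by omega)]
  have hR' : Rk z1 z2 (k + 1) = RM (k % r + 1) (r - 1 - k / r) z1 z2 := by
    unfold Rk
    have hq : (k : ℕ) / r < r := Nat.div_lt_of_lt_mul hk
    have hd := Nat.div_add_mod k r
    have hm := Nat.mod_lt (k : ℕ) hr
    generalize hqq : (k : ℕ) / r = q at *
    generalize hmm : (k : ℕ) % r = m at *
    by_cases hlt : m + 1 < r
    · have h1 : ((k : ℕ) + 1) % r = m + 1 := by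
        rw [← hd, add_assoc, Nat.mul_add_mod, Nat.mod_eq_of_lt hlt]
      have h2 : ((k : ℕ) + 1) / r = q := by
        rw [← hd, add_assoc, Nat.mul_add_div hr, Nat.div_eq_of_lt hlt, add_zero]
      rw [h1, h2, if_neg]
      intro h; rw [h] at h1; simp at h1
    · have hm1 : m + 1 = r := by omega
      have hk1 : (k : ℕ) + 1 = r * (q + 1) := by rw [mul_add, mul_one]; omega
      have h1 : ((k : ℕ) + 1) % r = 0 := by rw [hk1]; simp
      have h2 : ((k : ℕ) + 1) / r = q + 1 := by rw [hk1]; exact Nat.mul_div_cancel_left _ hr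
      rw [h1, h2, hm1]
      symm
      apply RM_wrap _ _ hr
      by_cases hq1 : q + 1 = r
      · right
        rw [if_pos (by rw [hk1, hq1])]; omega
      · left
        rw [if_neg]
        · omega
        · intro h; rw [hk1] at h; exact hq1 (Nat.eq_of_mul_eq_mul_left hr h)
  rw [hR, hR']; exact h

theorem Rk_col (B : ℕ) (z1 z2 : PolyR r) (n n'' : Fin (r * r) → ℕ) (hB : ∀ k, n k + 2 ≤ B) :
    RM 0 (r - 1) z1 z2 * (List.ofFn fun k => uM B z1 z2 (bosonOfIdx k) (n k) (n'' k)).prod =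
    (List.ofFn fun k => uM B z2 z1 (bosonOfIdx k) (n k) (n'' k)).prod * RM 0 (r - 1) z1 z2 := by
  have := train (r * r) (Rk z1 z2) _ _ (fun k => Rk_step B z1 z2 k (n k) (n'' k) (hB k))
  have h0 : Rk z1 z2 0 = RM 0 (r - 1) z1 z2 := by unfold Rk; simp
  have h1 : Rk z1 z2 (r * r) = RM 0 (r - 1) z1 z2 := by unfold Rk; simp
  rwa [h0, h1] at this

end YB


namespace YB

variable {r : ℕ}

open scoped Kronecker

/-- Transfer matrix of a vertex. -/
noncomputable def vM (z : PolyR r) (m m' : Fin r × Fin r → ℕ) :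
    Matrix (Spin r) (Spin r) (PolyR r) :=
  (List.ofFn fun k : Fin (r * r) =>
    sW z (bosonOfIdx k) (m (bosonOfIdx k)) (m' (bosonOfIdx k))).prod

theorem sW_step (z : PolyR r) (m m' : Fin r × Fin r → ℕ) (ab : Fin r × Fin r) (x y : Spin r)
    (h : StepOK m m' ab x y) :
    sW z ab (m ab) (m' ab) x y = stepWeight z (m ab) (m' ab) ab x := by
  rcases h with ⟨rfl, h⟩ | ⟨rfl, rfl, h⟩ | ⟨rfl, rfl, h⟩
  · simp [sW, stepWeight, h]
  · simp [sW, stepWeight, h, qn]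
  · simp [sW, stepWeight, h]
    intro h'; omega

theorem sW_notstep (z : PolyR r) (m m' : Fin r × Fin r → ℕ) (ab : Fin r × Fin r) (x y : Spin r)
    (h : ¬ StepOK m m' ab x y) : sW z ab (m ab) (m' ab) x y = 0 := by
  unfold StepOK at h
  push Not at h
  obtain ⟨h1, h2, h3⟩ := h
  simp only [sW]
  rw [if_neg (by tauto), if_neg (by tauto), if_neg (by tauto)]

theorem step_next (m m' : Fin r × Fin r → ℕ) (ab : Fin r × Fin r) (x y : Spin r)
    (h : StepOK m m' ab x y) : y = nextSpin m m' ab x := by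
  rcases h with ⟨rfl, h⟩ | ⟨rfl, rfl, h⟩ | ⟨rfl, rfl, h⟩ <;> simp [nextSpin, h]
  omega

theorem path_eq (m m' : Fin r × Fin r → ℕ) (l : Spin r) (x : Fin (r * r + 1) → Spin r)
    (h0 : x 0 = l)
    (h : ∀ k : Fin (r * r), StepOK m m' (bosonOfIdx k) (x k.castSucc) (x k.succ)) :
    ∀ (k : ℕ) (hk : k < r * r + 1), x ⟨k, hk⟩ = pathSpin m m' l k := by
  intro k
  induction k with
  | zero => intro _; exact h0
  | succ k ih =>
    intro hk
    have hk' : k < r * r := by omega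
    have := step_next _ _ _ _ _ (h ⟨k, hk'⟩)
    simp only [pathSpin, dif_pos hk']
    rw [← ih (by omega)]
    exact this

theorem vM_eq (z : PolyR r) (m m' : Fin r × Fin r → ℕ) (l rr : Spin r) :
    vM z m m' l rr = Wvert z l m rr m' := by
  unfold vM Wvert
  rw [path_prod]
  split_ifs with hA
  · obtain ⟨x, hx0, hx1, hx⟩ := hA
    rw [Finset.sum_eq_single x]
    · rw [if_pos ⟨hx0, hx1⟩]
      unfold vertexWeight
      apply Finset.prod_congr rfl
      intro k _
      rw [sW_step _ _ _ _ _ _ (hx k), ← path_eq m m' l x hx0 hx k (by omega)]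
      rfl
    · intro y _ hy
      split_ifs with h
      · by_contra hne
        apply hy
        have hy' : ∀ k : Fin (r * r), StepOK m m' (bosonOfIdx k) (y k.castSucc) (y k.succ) := by
          intro k
          by_contra hk
          apply hne
          exact Finset.prod_eq_zero (Finset.mem_univ k) (sW_notstep _ _ _ _ _ _ hk)
        funext k
        rw [← Fin.eta k k.2, path_eq m m' l x hx0 hx, path_eq m m' l y h.1 hy']
      · rfl
    · simp
  · apply Finset.sum_eq_zero
    intro y _
    split_ifs with h
    · by_contra hne
      apply hA
      refine ⟨y, h.1, h.2, ?_⟩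
      intro k
      by_contra hk
      apply hne
      exact Finset.prod_eq_zero (Finset.mem_univ k) (sW_notstep _ _ _ _ _ _ hk)
    · rfl

theorem bos_inj : Function.Injective (bosonOfIdx : Fin (r * r) → Fin r × Fin r) := by
  intro k k' h
  have hr : 0 < r := by
    rcases Nat.eq_zero_or_pos r with h | h
    · exact absurd k.2 (by simp [h])
    · exact h
  have h1 : (k : ℕ) % r = (k' : ℕ) % r := congrArg (fun p => (p.1 : ℕ)) h
  have h2 : r - 1 - (k : ℕ) / r = r - 1 - (k' : ℕ) / r := congrArg (fun p => (p.2 : ℕ)) h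
  have q1 : (k : ℕ) / r < r := Nat.div_lt_of_lt_mul k.2
  have q2 : (k' : ℕ) / r < r := Nat.div_lt_of_lt_mul k'.2
  have h3 : (k : ℕ) / r = (k' : ℕ) / r := by omega
  apply Fin.ext
  rw [← Nat.div_add_mod (k : ℕ) r, ← Nat.div_add_mod (k' : ℕ) r, h1, h3]

noncomputable def bosE (r : ℕ) : Fin (r * r) ≃ Fin r × Fin r :=
  Equiv.ofBijective bosonOfIdx
    ((Fintype.bijective_iff_injective_and_card _).2 ⟨bos_inj, by simp⟩)

theorem vM_zero (z : PolyR r) (m m' : Fin r × Fin r → ℕ) (ab : Fin r × Fin r)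
    (h : m ab + 2 ≤ m' ab) : vM z m m' = 0 := by
  unfold vM
  apply List.prod_eq_zero
  rw [List.mem_ofFn]
  refine ⟨(bosE r).symm ab, ?_⟩
  have : bosonOfIdx ((bosE r).symm ab) = ab := (bosE r).apply_symm_apply ab
  rw [this, sW_zero _ _ _ _ h]

/-- Two-row column matrix. -/
noncomputable def cM (B : ℕ) (z1 z2 : PolyR r) (m m'' : Fin r × Fin r → ℕ) :
    Matrix (Spin r × Spin r) (Spin r × Spin r) (PolyR r) :=
  ∑ m' : Fin r × Fin r → Fin B, (vM z1 m (fun ab => m' ab)) ⊗ₖ (vM z2 (fun ab => m' ab) m'')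

theorem cM_eq (B : ℕ) (z1 z2 : PolyR r) (m m'' : Fin r × Fin r → ℕ) :
    cM B z1 z2 m m'' = (List.ofFn fun k : Fin (r * r) =>
      uM B z1 z2 (bosonOfIdx k) (m (bosonOfIdx k)) (m'' (bosonOfIdx k))).prod := by
  unfold cM uM vM
  rw [← sum_pi_prod (r * r) (fun k (n' : Fin B) =>
    (sW z1 (bosonOfIdx k) (m (bosonOfIdx k)) n') ⊗ₖ
      (sW z2 (bosonOfIdx k) n' (m'' (bosonOfIdx k))))]
  rw [← ((bosE r).arrowCongr (Equiv.refl (Fin B))).sum_comp]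
  apply Finset.sum_congr rfl
  intro f _
  rw [← kron_prod]
  have : ∀ k, (bosE r).symm (bosonOfIdx k) = k := fun k => (bosE r).symm_apply_apply k
  simp [this]

theorem cM_ybe (B : ℕ) (z1 z2 : PolyR r) (m m'' : Fin r × Fin r → ℕ) (hB : ∀ ab, m ab + 2 ≤ B) :
    RM 0 (r - 1) z1 z2 * cM B z1 z2 m m'' = cM B z2 z1 m m'' * RM 0 (r - 1) z1 z2 := by
  rw [cM_eq, cM_eq]
  exact Rk_col B z1 z2 _ _ (fun k => hB _)

abbrev Cfg (r N : ℕ) := Fin N → Fin r × Fin r → ℕ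

variable {N : ℕ}

/-- Row kernel. -/
noncomputable def ker (z : PolyR r) (x y : Spin r) (M M' : Cfg r N) : PolyR r :=
  (List.ofFn fun j : Fin N => (vM z (M j) (M' j)).transpose).prod y x

theorem ker_zero (z : PolyR r) (x y : Spin r) (M M' : Cfg r N) (j : Fin N) (ab : Fin r × Fin r)
    (h : M j ab + 2 ≤ M' j ab) : ker z x y M M' = 0 := by
  unfold ker
  rw [List.prod_eq_zero]
  · rfl
  · rw [List.mem_ofFn]; exact ⟨j, by rw [vM_zero _ _ _ _ h]; simp⟩

abbrev FCfg (r N B : ℕ) := Fin N → Fin r × Fin r → Fin B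

def toC {B : ℕ} (M : FCfg r N B) : Cfg r N := fun j ab => M j ab

/-- Row operator. -/
noncomputable def T (B : ℕ) (z : PolyR r) (x y : Spin r) (G : Cfg r N → PolyR r)
    (M : Cfg r N) : PolyR r :=
  ∑ M' : FCfg r N B, ker z x y M (toC M') * G (toC M')

noncomputable def K2 (B : ℕ) (z1 z2 : PolyR r) (x1 x2 y1 y2 : Spin r) (M M'' : Cfg r N) :
    PolyR r :=
  ∑ M' : FCfg r N B, ker z1 x1 y1 M (toC M') * ker z2 x2 y2 (toC M') M''

theorem T_T (B : ℕ) (z1 z2 : PolyR r) (x1 x2 y1 y2 : Spin r) (G : Cfg r N → PolyR r)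
    (M : Cfg r N) : T B z1 x1 y1 (T B z2 x2 y2 G) M =
      ∑ M'' : FCfg r N B, K2 B z1 z2 x1 x2 y1 y2 M (toC M'') * G (toC M'') := by
  unfold T K2
  simp only [Finset.mul_sum, Finset.sum_mul, mul_assoc]
  rw [Finset.sum_comm]

theorem K2_eq (B : ℕ) (z1 z2 : PolyR r) (x1 x2 y1 y2 : Spin r) (M M'' : Cfg r N) :
    K2 B z1 z2 x1 x2 y1 y2 M M'' =
      (List.ofFn fun j : Fin N => (cM B z1 z2 (M j) (M'' j)).transpose).prod (y1, y2) (x1, x2) := by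
  have : ∀ j : Fin N, (cM B z1 z2 (M j) (M'' j)).transpose =
      ∑ m' : Fin r × Fin r → Fin B, (vM z1 (M j) (fun ab => m' ab)).transpose ⊗ₖ
        (vM z2 (fun ab => m' ab) (M'' j)).transpose := by
    intro j
    unfold cM
    rw [Matrix.transpose_sum]
    rfl
  simp only [this]
  rw [← sum_pi_prod, Matrix.sum_apply]
  unfold K2 ker
  apply Finset.sum_congr rfl
  intro M' _
  rw [kron_prod]
  rfl

theorem K2_ybe (B : ℕ) (z1 z2 : PolyR r) (x1 x2 y1 y2 : Spin r) (M M'' : Cfg r N)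
    (hB : ∀ j ab, M j ab + 2 ≤ B) :
    keep 0 (r - 1) z1 z2 x1 x2 * K2 B z1 z2 x1 x2 y1 y2 M M'' +
      swp z1 z2 x1 x2 * K2 B z1 z2 x2 x1 y1 y2 M M'' =
    keep 0 (r - 1) z1 z2 y1 y2 * K2 B z2 z1 x1 x2 y1 y2 M M'' +
      swp z1 z2 y2 y1 * K2 B z2 z1 x1 x2 y2 y1 M M'' := by
  have h := train N (fun _ => (RM 0 (r - 1) z1 z2).transpose)
    (fun j => (cM B z2 z1 (M j) (M'' j)).transpose) (fun j => (cM B z1 z2 (M j) (M'' j)).transpose)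
    (fun j => by
      rw [← Matrix.transpose_mul, ← Matrix.transpose_mul, cM_ybe B z1 z2 _ _ (hB j)])
  have h' := congrArg (fun A => A.transpose (x1, x2) (y1, y2)) h
  simp only [Matrix.transpose_mul, Matrix.transpose_transpose] at h'
  rw [RM_mul, mul_RM] at h'
  simp only [Matrix.transpose_apply, ← K2_eq] at h'
  rw [← h']
  ring

theorem T_ybe (B : ℕ) (z1 z2 : PolyR r) (x1 x2 y1 y2 : Spin r) (G : Cfg r N → PolyR r)
    (M : Cfg r N) (hB : ∀ j ab, M j ab + 2 ≤ B) :
    keep 0 (r - 1) z1 z2 x1 x2 * T B z1 x1 y1 (T B z2 x2 y2 G) M +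
      swp z1 z2 x1 x2 * T B z1 x2 y1 (T B z2 x1 y2 G) M =
    keep 0 (r - 1) z1 z2 y1 y2 * T B z2 x1 y1 (T B z1 x2 y2 G) M +
      swp z1 z2 y2 y1 * T B z2 x1 y2 (T B z1 x2 y1 G) M := by
  simp only [T_T, Finset.mul_sum, ← Finset.sum_add_distrib, ← mul_assoc, ← add_mul]
  apply Finset.sum_congr rfl
  intro M'' _
  rw [K2_ybe B z1 z2 x1 x2 y1 y2 M _ hB]

end YB


namespace YB

variable {r N : ℕ}

abbrev Row (r : ℕ) := PolyR r × Spin r × Spin r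

noncomputable def base (M : Cfg r N) : PolyR r := by
  classical exact if M = 0 then 1 else 0

noncomputable def Zrec (B : ℕ) (G : Cfg r N → PolyR r) (rows : List (Row r)) :
    Cfg r N → PolyR r :=
  rows.foldr (fun ρ G => T B ρ.1 ρ.2.1 ρ.2.2 G) G

theorem Zrec_append (B : ℕ) (G : Cfg r N → PolyR r) (l l' : List (Row r)) :
    Zrec B G (l ++ l') = Zrec B (Zrec B G l') l := by
  unfold Zrec; rw [List.foldr_append]

theorem Zrec_lin (B : ℕ) (l : List (Row r)) (c1 c2 c3 c4 : PolyR r)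
    (G1 G2 G3 G4 : Cfg r N → PolyR r)
    (h : ∀ M : Cfg r N, (∀ j ab, M j ab + 2 ≤ B) →
      c1 * G1 M + c2 * G2 M = c3 * G3 M + c4 * G4 M) :
    ∀ M : Cfg r N, (∀ j ab, M j ab + l.length + 2 ≤ B) →
      c1 * Zrec B G1 l M + c2 * Zrec B G2 l M = c3 * Zrec B G3 l M + c4 * Zrec B G4 l M := by
  induction l with
  | nil => intro M hM; exact h M (fun j ab => by simpa using hM j ab)
  | cons ρ l ih =>
    intro M hM
    simp only [Zrec, List.foldr_cons, T, Finset.mul_sum, ← Finset.sum_add_distrib]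
    apply Finset.sum_congr rfl
    intro M' _
    by_cases hb : ∀ j ab, toC M' j ab ≤ M j ab + 1
    · have := ih (toC M') (fun j ab => by
        have := hb j ab
        have := hM j ab
        simp only [List.length_cons] at this
        omega)
      simp only [Zrec] at this
      linear_combination ker ρ.1 ρ.2.1 ρ.2.2 M (toC M') * this
    · push Not at hb
      obtain ⟨j, ab, hb⟩ := hb
      rw [ker_zero _ _ _ _ _ j ab (by omega)]
      ring

/-- levels of a configuration -/
def lev {B ρ : ℕ} (M : Cfg r N) (m : Fin ρ → FCfg r N B) : Fin (ρ + 1) → Cfg r N :=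
  Fin.cons M (fun i => toC (m i))

theorem Zrec_sum (B : ℕ) (G : Cfg r N → PolyR r) (n : ℕ) (rows : Fin n → Row r) (M : Cfg r N) :
    Zrec B G (List.ofFn rows) M = ∑ m : Fin n → FCfg r N B,
      (∏ i, ker (rows i).1 (rows i).2.1 (rows i).2.2 (lev M m i.castSucc) (lev M m i.succ)) *
        G (lev M m (Fin.last n)) := by
  induction n generalizing M with
  | zero => simp [Zrec, lev]
  | succ n ih =>
    rw [← (Fin.consEquiv (fun _ => FCfg r N B)).sum_comp, Fintype.sum_prod_type]
    simp only [List.ofFn_succ]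
    have : Zrec B G (rows 0 :: List.ofFn fun i => rows i.succ) M =
      T B (rows 0).1 (rows 0).2.1 (rows 0).2.2 (Zrec B G (List.ofFn fun i => rows i.succ)) M := rfl
    rw [this]
    unfold T
    apply Finset.sum_congr rfl
    intro M' _
    rw [ih, Finset.mul_sum]
    apply Finset.sum_congr rfl
    intro m _
    have hl : ∀ i : Fin (n + 1),
        lev M ((Fin.consEquiv fun _ => FCfg r N B) (M', m)) i.succ = lev (toC M') m i := by
      intro i
      refine Fin.cases ?_ (fun i => ?_) i
      · simp [lev]
      · simp [lev]
    have h0 : lev M ((Fin.consEquiv fun _ => FCfg r N B) (M', m)) 0 = M := by simp [lev]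
    rw [Fin.prod_univ_succ, ← Fin.succ_last, Fin.castSucc_zero, h0]
    simp only [hl, ← Fin.succ_castSucc]
    have h1 : lev (toC M') m 0 = toC M' := by simp [lev]
    rw [h1, mul_assoc]

theorem ker_path (z : PolyR r) (x y : Spin r) (M M' : Cfg r N) :
    ker z x y M M' = ∑ h : Fin (N + 1) → Spin r,
      if h 0 = y ∧ h (Fin.last N) = x then
        ∏ j, Wvert z (h j.succ) (M j) (h j.castSucc) (M' j) else 0 := by
  unfold ker
  rw [path_prod]
  simp only [Matrix.transpose_apply, vM_eq]

theorem adm_le (l rr : Spin r) (m m' : Fin r × Fin r → ℕ) (h : AdmissibleVertex l m rr m')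
    (ab : Fin r × Fin r) : m' ab ≤ m ab + 1 := by
  obtain ⟨x, _, _, hx⟩ := h
  have := hx ((bosE r).symm ab)
  have e : bosonOfIdx ((bosE r).symm ab) = ab := (bosE r).apply_symm_apply ab
  rw [e] at this
  rcases this with ⟨_, h⟩ | ⟨_, _, h⟩ | ⟨_, _, h⟩ <;> omega

/-- Initial configuration. -/
def M0 (N : ℕ) (lam : Fin r → ℕ) (w3 w4 : Equiv.Perm (Fin r)) : Cfg r N := fun j ab =>
  (Finset.univ.filter fun i : Fin r =>
    lam i = j.val ∧ w3⁻¹ i = ab.1 ∧ w4⁻¹ (Fin.rev i) = ab.2).card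

theorem M0_le (lam : Fin r → ℕ) (w3 w4 : Equiv.Perm (Fin r)) (j : Fin N) (ab : Fin r × Fin r) :
    M0 N lam w3 w4 j ab ≤ r := by
  unfold M0
  exact (Finset.card_le_univ _).trans (by simp)

def mkF (B : ℕ) (M : Cfg r N) (p : (Fin r → FCfg r N B) × (Fin r → Fin (N + 1) → Spin r)) :
    Filling r N := ⟨lev M p.1, p.2⟩

theorem mkF_inj (B : ℕ) (M : Cfg r N) : Function.Injective (mkF B M) := by
  rintro ⟨m, h⟩ ⟨m', h'⟩ e
  simp only [mkF, Filling.mk.injEq] at e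
  obtain ⟨e1, e2⟩ := e
  refine Prod.ext ?_ e2
  funext i j ab
  have := congrFun (congrFun (congrFun e1 i.succ) j) ab
  simpa [lev, toC, Fin.ext_iff] using this

theorem Z_eq (lam : Fin r → ℕ) (w1 w2 w3 w4 : Equiv.Perm (Fin r)) :
    partitionZ r N lam w1 w2 w3 w4 =
      Zrec (2 * r + 5) base (List.ofFn fun i : Fin r => ((zP i, Sum.inr (w2⁻¹ i), Sum.inl (w1⁻¹ i)) : Row r))
        (M0 N lam w3 w4) := by
  classical
  unfold partitionZ
  set B := 2 * r + 5 with hB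
  set F : Filling r N → PolyR r := fun f => if InSystem lam w1 w2 w3 w4 f then stateWeight f else 0
    with hF
  have hsupp : ∀ f : Filling r N, F f ≠ 0 → f ∈ Set.range (mkF B (M0 N lam w3 w4)) := by
    intro f hf
    have hs : InSystem lam w1 w2 w3 w4 f := by
      by_contra h; apply hf; simp [hF, h]
    obtain ⟨hst, h0, _, _, _⟩ := hs
    have h0' : f.m 0 = M0 N lam w3 w4 := by
      funext j ab; exact h0 j ab.1 ab.2
    have hle : ∀ (n : ℕ) (hn : n < r + 1) (j : Fin N) (ab : Fin r × Fin r),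
        f.m ⟨n, hn⟩ j ab ≤ r + n := by
      intro n
      induction n with
      | zero =>
        intro hn j ab
        have : f.m ⟨0, hn⟩ = M0 N lam w3 w4 := h0'
        rw [this]; exact M0_le _ _ _ _ _
      | succ n ih =>
        intro hn j ab
        have h1 := ih (by omega) j ab
        have h2 := adm_le _ _ _ _ (hst ⟨n, by omega⟩ j) ab
        simp only [Fin.castSucc_mk, Fin.succ_mk] at h2
        omega
    refine ⟨(fun i j ab => ⟨f.m i.succ j ab, ?_⟩, f.h), ?_⟩
    · have h1 := hle (i + 1) (by omega) j ab
      have h2 : f.m i.succ j ab ≤ r + (i + 1) := h1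
      omega
    · cases f with
      | mk m h =>
        simp only [mkF, Filling.mk.injEq, and_true]
        funext i
        refine Fin.cases ?_ (fun i => ?_) i
        · simp only [lev, Fin.cons_zero]; exact h0'.symm
        · simp only [lev, Fin.cons_succ]; rfl
  have h1 : finsum F = ∑ p, F (mkF B (M0 N lam w3 w4) p) := by
    rw [← finsum_eq_sum_of_fintype, ← finsum_mem_range (mkF_inj B _), ← finsum_mem_support F,
      ← finsum_mem_inter_support F (Set.range _)]
    rw [Set.inter_eq_right.2]
    exact fun f hf => hsupp f hf
  rw [h1, Zrec_sum, Fintype.sum_prod_type]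
  apply Finset.sum_congr rfl
  intro m _
  simp only [ker_path]
  rw [Finset.prod_univ_sum, Fintype.piFinset_univ, Finset.sum_mul]
  apply Finset.sum_congr rfl
  intro h _
  set M := M0 N lam w3 w4
  simp only [hF]
  split_ifs with hs
  · obtain ⟨hst, h0, hb, hy, hx⟩ := hs
    have e1 : base (lev M m (Fin.last r)) = 1 := by
      have : lev M m (Fin.last r) = 0 := by funext j ab; exact hb j ab
      unfold base; simp [this]
    rw [e1, mul_one]
    unfold stateWeight
    apply Finset.prod_congr rfl
    intro i _
    rw [if_pos ⟨hy i, hx i⟩]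
    apply Finset.prod_congr rfl
    intro j _
    unfold Wvert
    rw [if_pos]
    · rfl
    · exact hst i j
  · by_contra hne
    have hne' := Ne.symm hne
    have n1 := left_ne_zero_of_mul hne'
    have n2 := right_ne_zero_of_mul hne'
    rw [Finset.prod_ne_zero_iff] at n1
    have n3 : ∀ i : Fin r, h i 0 = Sum.inl (w1⁻¹ i) ∧ h i (Fin.last N) = Sum.inr (w2⁻¹ i) := by
      intro i
      by_contra hc
      apply n1 i (Finset.mem_univ _)
      rw [if_neg hc]
    apply hs
    refine ⟨?_, ?_, ?_, fun i => (n3 i).1, fun i => (n3 i).2⟩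
    · intro i j
      have := n1 i (Finset.mem_univ _)
      rw [if_pos (n3 i), Finset.prod_ne_zero_iff] at this
      have := this j (Finset.mem_univ _)
      by_contra hc
      apply this
      unfold Wvert
      rw [if_neg]
      exact hc
    · intro j a b; rfl
    · intro j ab
      by_contra hc
      apply n2
      unfold base
      rw [if_neg]
      intro h0
      apply hc
      exact congrFun (congrFun h0 j) ab

end YB


namespace YB

variable {r N : ℕ}

/-! ### The action of the transposition on polynomials -/

theorem map_pass (φ : PolyR r →+* PolyR r) (hφ : φ (tP r) = tP r) (z : PolyR r) (n : ℕ) (ab : Fin r × Fin r) (x : Spin r) :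
    φ (passWeight z n ab x) = passWeight (φ z) n ab x := by
  rcases x with e | e <;> simp only [passWeight] <;> split_ifs <;> simp [hφ]

theorem map_step (φ : PolyR r →+* PolyR r) (hφ : φ (tP r) = tP r) (z : PolyR r) (m m' : ℕ) (ab : Fin r × Fin r) (x : Spin r) :
    φ (stepWeight z m m' ab x) = stepWeight (φ z) m m' ab x := by
  unfold stepWeight
  split_ifs
  · simp [hφ]
  · simp [hφ]
  · exact map_pass φ hφ _ _ _ _

theorem map_W (φ : PolyR r →+* PolyR r) (hφ : φ (tP r) = tP r) (z : PolyR r) (l rr : Spin r) (m m' : Fin r × Fin r → ℕ) :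
    φ (Wvert z l m rr m') = Wvert (φ z) l m rr m' := by
  unfold Wvert
  split_ifs
  · unfold vertexWeight
    rw [map_prod]
    simp only [map_step φ hφ]
  · simp

theorem map_ker (φ : PolyR r →+* PolyR r) (hφ : φ (tP r) = tP r) (z : PolyR r) (x y : Spin r) (M M' : Cfg r N) :
    φ (ker z x y M M') = ker (φ z) x y M M' := by
  rw [ker_path, ker_path, map_sum]
  apply Finset.sum_congr rfl
  intro h _
  split_ifs
  · rw [map_prod]; simp only [map_W φ hφ]
  · simp

theorem map_Zrec (φ : PolyR r →+* PolyR r) (hφ : φ (tP r) = tP r) (B : ℕ) (l : List (Row r)) (M : Cfg r N) :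
    φ (Zrec B base l M) = Zrec B base (l.map fun ρ => (φ ρ.1, ρ.2)) M := by
  induction l generalizing M with
  | nil => simp only [Zrec, List.foldr_nil, List.map_nil, base]; split_ifs <;> simp
  | cons ρ l ih =>
    simp only [Zrec, List.foldr_cons, List.map_cons, T] at ih ⊢
    rw [map_sum]
    apply Finset.sum_congr rfl
    intro M' _
    rw [map_mul, map_ker φ hφ, ih]


noncomputable def phi (a b : Fin r) : PolyR r →+* PolyR r :=
  (MvPolynomial.rename (Option.map (Equiv.swap a b))).toRingHom

theorem phi_t (a b : Fin r) : phi a b (tP r) = tP r := by simp [phi, tP]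

theorem phi_z (a b i : Fin r) : phi a b (zP i) = zP (Equiv.swap a b i) := by simp [phi, zP]

theorem toFF_t : toFF r (tP r) = tF r := by simp [toFF, tP]

theorem toFF_z (i : Fin r) : toFF r (zP i) = zF i := by simp [toFF, zP]

theorem sig_t (a b : Fin r) : sigmaF a b (tF r) = tF r := by
  unfold sigmaF tF
  rw [IsFractionRing.ringEquivOfRingEquiv_algebraMap]
  simp

theorem sig_z (a b i : Fin r) : sigmaF a b (zF i) = zF (Equiv.swap a b i) := by
  unfold sigmaF zF
  rw [IsFractionRing.ringEquivOfRingEquiv_algebraMap]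
  simp

theorem sig_toFF (a b : Fin r) (p : PolyR r) : sigmaF a b (toFF r p) = toFF r (phi a b p) := by
  have : ((sigmaF a b : FFld r ≃+* FFld r) : FFld r →+* FFld r).comp (toFF r)
      = (toFF r).comp (phi a b) := by
    apply MvPolynomial.ringHom_ext
    · intro n; simp
    · intro o
      cases o with
      | none =>
        have h1 := sig_t a b
        have h2 := phi_t a b
        rw [← toFF_t] at h1
        simp only [RingHom.comp_apply]
        change sigmaF a b (toFF r (tP r)) = toFF r (phi a b (tP r))
        rw [h1, h2]
      | some i =>
        change sigmaF a b (toFF r (zP i)) = toFF r (phi a b (zP i))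
        rw [phi_z, toFF_z, toFF_z, sig_z]
  exact congrArg (fun g => g p) this

/-! ### Inversions -/

theorem inv_lt (a b : Fin r) (hab : (a : ℕ) + 1 = b) (w : Equiv.Perm (Fin r))
    (h : invCount (Equiv.swap a b * w) < invCount w) : w⁻¹ b < w⁻¹ a := by
  by_contra hc
  have hc' : w⁻¹ a ≤ w⁻¹ b := not_lt.1 hc
  apply absurd h
  rw [not_lt]
  unfold invCount
  apply Finset.card_le_card
  rw [Finset.subset_iff]
  intro p hp
  rw [Finset.mem_filter] at hp ⊢
  simp only [Finset.mem_univ, true_and, Equiv.Perm.coe_mul,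
    Function.comp_apply] at hp ⊢
  refine ⟨hp.1, ?_⟩
  have hne : ¬ (w p.2 = a ∧ w p.1 = b) := by
    rintro ⟨e1, e2⟩
    have f1 : p.2 = w⁻¹ a := by rw [← e1]; simp
    have f2 : p.1 = w⁻¹ b := by rw [← e2]; simp
    rw [← f1, ← f2] at hc'
    exact absurd hp.1 (not_lt.2 hc')
  have hlt := hp.2
  generalize w p.2 = u at *
  generalize w p.1 = v at *
  simp only [Equiv.swap_apply_def]
  simp only [Fin.ext_iff, Fin.lt_def] at *
  split_ifs <;> omega

/-! ### Splitting the row list -/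

theorem ofFn_split {X : Type*} (f : Fin r → X) (a b : Fin r) (hab : (a : ℕ) + 1 = b) :
    ∃ P S : List X, P.length ≤ r ∧ ∀ g : Fin r → X, (∀ i, i ≠ a → i ≠ b → g i = f i) →
      List.ofFn g = P ++ g a :: g b :: S := by
  refine ⟨(List.ofFn f).take a, (List.ofFn f).drop (a + 2), by simp, ?_⟩
  intro g hg
  have ha := a.2
  have hb := b.2
  have h1 : (List.ofFn f).take a = (List.ofFn g).take a := by
    apply List.ext_getElem
    · simp
    · intro n h1 h2
      simp only [List.length_take, List.length_ofFn] at h1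
      simp only [List.getElem_take, List.getElem_ofFn]
      rw [hg] <;> (intro h; have := congrArg Fin.val h; simp at this; omega)
  have h2 : (List.ofFn f).drop (a + 2) = (List.ofFn g).drop (a + 2) := by
    apply List.ext_getElem
    · simp
    · intro n h1 h2
      simp only [List.getElem_drop, List.getElem_ofFn]
      rw [hg] <;> (intro h; have := congrArg Fin.val h; simp at this; omega)
  rw [h1, h2]
  conv_lhs => rw [← List.take_append_drop a (List.ofFn g)]
  rw [List.drop_eq_getElem_cons (by simp), List.drop_eq_getElem_cons (by simp; omega)]
  simp only [List.getElem_ofFn, Fin.eta]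
  have : (⟨(a : ℕ) + 1, by omega⟩ : Fin r) = b := Fin.ext hab
  rw [this]

/-! ### The main polynomial identity -/

theorem keep_d (z1 z2 : PolyR r) {e f : Fin r} (h : f < e) :
    keep 0 (r - 1) z1 z2 (Sum.inr e) (Sum.inr f) = (1 - tP r) * z1 ^ 2 * z2 := by
  have e1 := e.2
  have e2 := f.2
  have : ke 0 (r - 1) (Sum.inr e : Spin r) (Sum.inr f) = 2 := by
    simp only [ke, if_pos h, if_true]
    rw [if_neg (by omega), if_neg (by omega)]
  unfold keep
  rw [this, if_neg]
  · simp
  · intro h'; rw [Sum.inr.injEq] at h'; exact h.ne' h'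

theorem keep_c (z1 z2 : PolyR r) {e f : Fin r} (h : f < e) :
    keep 0 (r - 1) z1 z2 (Sum.inl e) (Sum.inl f) = (1 - tP r) * z1 ^ 2 * z2 := by
  have : ke 0 (r - 1) (Sum.inl e : Spin r) (Sum.inl f) = 2 := by
    simp [ke, if_pos h]
  unfold keep
  rw [this, if_neg]
  · simp
  · intro h'; rw [Sum.inl.injEq] at h'; exact h.ne' h'

theorem swp_d (z1 z2 : PolyR r) {e f : Fin r} (h : f < e) :
    swp z1 z2 (Sum.inr e) (Sum.inr f) = z1 * z2 * (z1 - z2) := by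
  unfold swp
  rw [if_neg]
  · simp [tw, not_lt.2 h.le]
  · intro h'; rw [Sum.inr.injEq] at h'; exact h.ne' h'

theorem swp_c (z1 z2 : PolyR r) {e f : Fin r} (h : f < e) :
    swp z1 z2 (Sum.inl f) (Sum.inl e) = z1 * z2 * (z1 - z2) := by
  unfold swp
  rw [if_neg]
  · simp [tw, not_lt.2 h.le]
  · intro h'; rw [Sum.inl.injEq] at h'; exact h.ne h'

theorem main_poly (lam : Fin r → ℕ) (w1 w2 w3 w4 : Equiv.Perm (Fin r)) (a b : Fin r)
    (hab : (a : ℕ) + 1 = b) (hw1 : w1⁻¹ b < w1⁻¹ a) (hw2 : w2⁻¹ b < w2⁻¹ a) :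
    (1 - tP r) * zP a ^ 2 * zP b * partitionZ r N lam w1 w2 w3 w4 +
      zP a * zP b * (zP a - zP b) * partitionZ r N lam w1 (Equiv.swap a b * w2) w3 w4 =
    (1 - tP r) * zP a ^ 2 * zP b * phi a b (partitionZ r N lam w1 w2 w3 w4) +
      zP a * zP b * (zP a - zP b) *
        phi a b (partitionZ r N lam (Equiv.swap a b * w1) w2 w3 w4) := by
  have hne : a ≠ b := by intro h; rw [h] at hab; omega
  rw [Z_eq, Z_eq, Z_eq, map_Zrec _ (phi_t a b), map_Zrec _ (phi_t a b), List.map_ofFn,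
    List.map_ofFn]
  obtain ⟨P, S, hP, hPS⟩ := ofFn_split
    (fun i : Fin r => ((zP i, Sum.inr (w2⁻¹ i), Sum.inl (w1⁻¹ i)) : Row r)) a b hab
  have hsw : ∀ i, i ≠ a → i ≠ b → Equiv.swap a b i = i :=
    fun i h1 h2 => Equiv.swap_apply_of_ne_of_ne h1 h2
  rw [hPS _ (fun i _ _ => rfl)]
  rw [hPS _ (fun i h1 h2 => by simp [hsw i h1 h2])]
  rw [hPS _ (fun i h1 h2 => by simp [phi_z, hsw i h1 h2])]
  rw [hPS _ (fun i h1 h2 => by simp [phi_z, hsw i h1 h2])]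
  simp only [Function.comp_apply, phi_z, mul_inv_rev, Equiv.swap_inv, Equiv.Perm.coe_mul,
    Equiv.swap_apply_left, Equiv.swap_apply_right, Zrec_append]
  apply Zrec_lin
  · intro M hM
    have h := T_ybe (2 * r + 5) (zP a) (zP b) (Sum.inr (w2⁻¹ a)) (Sum.inr (w2⁻¹ b))
      (Sum.inl (w1⁻¹ a)) (Sum.inl (w1⁻¹ b)) (Zrec (2 * r + 5) base S) M hM
    rw [keep_d _ _ hw2, keep_c _ _ hw1, swp_d _ _ hw2, swp_c _ _ hw1] at h
    exact h
  · intro j ab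
    have := M0_le lam w3 w4 j ab
    omega

theorem zF_inj {a b : Fin r} (h : (zF a : FFld r) = zF b) : a = b := by
  unfold zF at h
  have := IsFractionRing.injective (MvPolynomial (Fin r) Kt) (FFld r) h
  exact MvPolynomial.X_injective this

theorem zF_ne (a : Fin r) : (zF a : FFld r) ≠ 0 := by
  intro h
  unfold zF at h
  rw [← map_zero (algebraMap (MvPolynomial (Fin r) Kt) (FFld r))] at h
  have := IsFractionRing.injective (MvPolynomial (Fin r) Kt) (FFld r) h
  exact MvPolynomial.X_ne_zero a this

end YB

/-- if ℓ(s w₁) < ℓ(w₁) and ℓ(s w₂) < ℓ(w₂) then (1-t)·D⁽¹⁾(Z(w₁,w₂)) = σ(Z(s w₁, w₂)) − Z(w₁, s w₂). -/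
theorem stmt10 (r N : ℕ) (hr : 2 ≤ r) (hN : 1 ≤ N)
    (lam : Fin r → ℕ)
    (hpart : ∀ i j : Fin r, i ≤ j → lam j ≤ lam i)
    (hlam1 : lam ⟨0, by omega⟩ ≤ N - 1)
    (w3 w4 : Equiv.Perm (Fin r))
    (w1 w2 : Equiv.Perm (Fin r))
    (i : ℕ) (h1 : 1 ≤ i) (h2 : i ≤ r - 1) :
    let a : Fin r := ⟨i - 1, by omega⟩
    let b : Fin r := ⟨i, by omega⟩
    let s : Equiv.Perm (Fin r) := Equiv.swap a b
    let Z : Equiv.Perm (Fin r) → Equiv.Perm (Fin r) → FFld r := fun u v =>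
      toFF r (partitionZ r N lam u v w3 w4)
    invCount (s * w1) < invCount w1 →
    invCount (s * w2) < invCount w2 →
    (1 - tF r) * DF1 a b (Z w1 w2) = sigmaF a b (Z (s * w1) w2) - Z w1 (s * w2) := by
  intro a b s Z hw1 hw2
  have hab : (a : ℕ) + 1 = b := by
    change i - 1 + 1 = i
    omega
  have hne : a ≠ b := by intro h; rw [h] at hab; omega
  have hm := congrArg (toFF r) (YB.main_poly (N := N) lam w1 w2 w3 w4 a b hab
    (YB.inv_lt a b hab w1 hw1) (YB.inv_lt a b hab w2 hw2))
  simp only [map_add, map_mul, map_sub, map_pow, map_one, YB.toFF_t, YB.toFF_z,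
    ← YB.sig_toFF] at hm
  change (1 - tF r) * zF a ^ 2 * zF b * Z w1 w2 + zF a * zF b * (zF a - zF b) * Z w1 (s * w2) =
    (1 - tF r) * zF a ^ 2 * zF b * sigmaF a b (Z w1 w2) +
      zF a * zF b * (zF a - zF b) * sigmaF a b (Z (s * w1) w2) at hm
  have n1 := YB.zF_ne a
  have n2 := YB.zF_ne b
  have n3 : (zF a - zF b : FFld r) ≠ 0 := fun h => hne (YB.zF_inj (sub_eq_zero.1 h))
  unfold DF1
  apply mul_left_cancel₀ (mul_ne_zero (mul_ne_zero n1 n2) n3)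
  generalize sigmaF a b (Z w1 w2) = A at *
  generalize sigmaF a b (Z (s * w1) w2) = A' at *
  have n4 : (zF a - zF b : FFld r) * (zF a - zF b)⁻¹ = 1 := mul_inv_cancel₀ n3
  linear_combination hm + (1 - tF r) * zF a * zF b * (zF a * Z w1 w2 - zF a * A) * n4
end

section
/- Suppose ℓ(s_i∘w_1) > ℓ(w_1) and ℓ(s_i∘w_2) < ℓ(w_2). Then (1−t)·D_i^{(2)}(Z(w_1,w_2)) = t·σ_i(Z(s_i∘w_1, w_2)) − Z(w_1, s_i∘w_2) in K(z_1,…,z_r). -/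
section YBalg
variable {A : Type*} [CommRing A] {r : ℕ}

/-- pass weight over a general ring -/
def pwG (t z : A) (ab : Fin r × Fin r) (n : ℕ) (x : Spin r) : A :=
  match x with
  | Sum.inl e => if e = ab.1 then z else if e < ab.1 then t ^ n else 1
  | Sum.inr e =>
      if e = ab.2 then 1
      else if ab.1.val = 0 then (if e < ab.2 then t ^ n * z else z)
      else (if e < ab.2 then t ^ n else 1)

/-- weight of a split or a merge over a general ring -/
def cwG (t z : A) (ab : Fin r × Fin r) (n : ℕ) (x : Spin r) : A :=
  match x with
  | Sum.inl e => if e = ab.1 then (1 - t) * z else 0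
  | Sum.inr e => if e = ab.2 then ∑ j ∈ Finset.range n, t ^ j else 0

/-- the spin after a split or merge -/
def cxG (ab : Fin r × Fin r) (x : Spin r) : Spin r :=
  match x with
  | Sum.inl _ => Sum.inr ab.2
  | Sum.inr _ => Sum.inl ab.1

/-- the multiplicity after a split or merge -/
def cnG (x : Spin r) (n : ℕ) : ℕ :=
  match x with
  | Sum.inl _ => n + 1
  | Sum.inr _ => n - 1

/-- single boson transfer operator -/
def stpG (t z : A) (ab : Fin r × Fin r) (F : Spin r → ℕ → A) (x : Spin r) (n : ℕ) : A :=
  pwG t z ab n x * F x n + cwG t z ab n x * F (cxG ab x) (cnG x n)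

/-- exponent in the R-matrix before boson `(a,b)`. -/
def alphaG (r a b : ℕ) (x y : Spin r) : ℕ :=
  match x, y with
  | Sum.inl e, Sum.inl f =>
      if (f.val < e.val ∧ ¬ (f.val < a ∧ a ≤ e.val)) ∨ (e.val < f.val ∧ e.val < a ∧ a ≤ f.val)
      then 2 else 1
  | Sum.inr e, Sum.inr f =>
      if (if e.val < b ∨ (e.val = b ∧ a = 0) then b - e.val else b + r - e.val) <
        (if f.val < b ∨ (f.val = b ∧ a = 0) then b - f.val else b + r - f.val) then 2 else 1
  | Sum.inl e, Sum.inr f => if f.val = b ∨ a = 0 ∨ e.val < a then 1 else 0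
  | Sum.inr f, Sum.inl e => if f.val = b ∨ a = 0 ∨ e.val < a then 2 else 3

/-- fixed order on spins -/
def swpG (t : A) (x y : Spin r) : A :=
  match x, y with
  | Sum.inl e, Sum.inl f => if e < f then 1 else t
  | Sum.inr e, Sum.inr f => if f < e then 1 else t
  | Sum.inl _, Sum.inr _ => t
  | Sum.inr _, Sum.inl _ => 1

/-- the R-matrix -/
def RG (t zi zj : A) (al : Spin r → Spin r → ℕ) (G : Spin r → Spin r → A) (x y : Spin r) : A :=
  if x = y then (zi - t * zj) * (zi * zj) * G x y
  else (1 - t) * (zi ^ (al x y) * zj ^ (3 - al x y)) * G x y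
    + (zi - zj) * (zi * zj) * swpG t x y * G y x

lemma geo_tpow (t : A) (n : ℕ) : t ^ n = 1 - (1 - t) * ∑ j ∈ Finset.range n, t ^ j := by
  have := mul_neg_geom_sum t n
  rw [this]; ring

set_option maxHeartbeats 4000000 in
theorem ybe_step (t zi zj : A) (a b : Fin r) (G : Spin r → Spin r → ℕ → A) (x y : Spin r) (n : ℕ) :
    RG t zi zj (alphaG r a b)
      (fun x y => stpG t zi (a, b) (fun x' n' => stpG t zj (a, b) (fun y' n'' => G x' y' n'') y n') x n) x y
    = stpG t zj (a, b) (fun x' n' => stpG t zi (a, b)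
        (fun y' n'' => RG t zi zj (alphaG r (a + 1) b) (fun u v => G u v n'') x' y') y n') x n := by
  have hx : (∃ e, x = Sum.inl e ∧ e < a) ∨ (∃ e, x = Sum.inl e ∧ a < e) ∨ x = Sum.inl a ∨
    (∃ e, x = Sum.inr e ∧ e < b) ∨ (∃ e, x = Sum.inr e ∧ b < e) ∨ x = Sum.inr b := by
    rcases x with e | e
    · rcases lt_trichotomy e a with h | h | h <;> simp_all
    · rcases lt_trichotomy e b with h | h | h <;> simp_all
  have hy : (∃ e, y = Sum.inl e ∧ e < a) ∨ (∃ e, y = Sum.inl e ∧ a < e) ∨ y = Sum.inl a ∨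
    (∃ e, y = Sum.inr e ∧ e < b) ∨ (∃ e, y = Sum.inr e ∧ b < e) ∨ y = Sum.inr b := by
    rcases y with e | e
    · rcases lt_trichotomy e a with h | h | h <;> simp_all
    · rcases lt_trichotomy e b with h | h | h <;> simp_all
  rcases hx with ⟨e, rfl, he⟩ | ⟨e, rfl, he⟩ | rfl | ⟨e, rfl, he⟩ | ⟨e, rfl, he⟩ | rfl <;>
  rcases hy with ⟨f, rfl, hf⟩ | ⟨f, rfl, hf⟩ | rfl | ⟨f, rfl, hf⟩ | ⟨f, rfl, hf⟩ | rfl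
  all_goals have hbr := b.isLt
  all_goals have har := a.isLt
  all_goals rcases Nat.eq_zero_or_pos a.val with ha | ha
  all_goals try rw [Fin.lt_def] at he
  all_goals try rw [Fin.lt_def] at hf
  all_goals try (exfalso; omega)
  all_goals try have her := e.isLt
  all_goals try have hfr := f.isLt
  all_goals first | (have h3 := lt_trichotomy e f; rcases h3 with hef | rfl | hef) | skip
  all_goals try rw [Fin.lt_def] at hef
  all_goals try (exfalso; omega)
  all_goals rcases n with _ | n
  all_goals simp only [RG, stpG, pwG, cwG, cxG, cnG, swpG, alphaG, Sum.inl.injEq, Sum.inr.injEq,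
    reduceCtorEq, Fin.ext_iff, Fin.lt_def, if_true, if_false, zero_mul, add_zero, zero_add,
    true_and, and_true, false_and, and_false, true_or, or_true, false_or, or_false,
    not_true_eq_false, not_false_eq_true]
  all_goals try simp (disch := omega) only [if_pos, if_neg, Nat.add_sub_cancel, Nat.sub_add_cancel]
  all_goals try simp only [Finset.sum_range_succ, Finset.sum_range_zero, Finset.sum_range_one,
    pow_succ]
  all_goals try simp only [geo_tpow t n]
  all_goals ring
end YBalg


section YBops
variable {A : Type*} [CommRing A] {r N : ℕ}

/-- sites: column and boson -/
abbrev SiteG (N r : ℕ) := Fin N × (Fin r × Fin r)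

/-- transfer operator at one site of a row -/
def stpM (t z : A) (s : SiteG N r) (F : Spin r → (SiteG N r → ℕ) → A) (x : Spin r)
    (M : SiteG N r → ℕ) : A :=
  stpG t z s.2 (fun y n => F y (Function.update M s n)) x (M s)

/-- transfer operator along a list of sites -/
def rowOp (t z : A) : List (SiteG N r) → (Spin r → (SiteG N r → ℕ) → A) → Spin r →
    (SiteG N r → ℕ) → A
  | [], F => F
  | s :: L, F => stpM t z s (rowOp t z L F)

lemma rowOp_append (t z : A) (L L' : List (SiteG N r)) (F : Spin r → (SiteG N r → ℕ) → A) :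
    rowOp t z (L ++ L') F = rowOp t z L (rowOp t z L' F) := by
  induction L with
  | nil => rfl
  | cons s L ih => simp only [List.cons_append, rowOp, ih]

lemma stpM_comm (t z1 z2 : A) (s s' : SiteG N r) (h : s ≠ s')
    (H : Spin r → Spin r → (SiteG N r → ℕ) → A) (x y : Spin r) (M : SiteG N r → ℕ) :
    stpM t z1 s (fun x' M' => stpM t z2 s' (fun y' M'' => H x' y' M'') y M') x M
    = stpM t z2 s' (fun y' M' => stpM t z1 s (fun x' M'' => H x' y' M'') x M') y M := by
  simp only [stpM, stpG, Function.update_of_ne h, Function.update_of_ne h.symm,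
    Function.update_comm h]
  ring

lemma rowOp_stpM_comm (t z1 z2 : A) (s' : SiteG N r) (L : List (SiteG N r)) (h : s' ∉ L)
    (H : Spin r → Spin r → (SiteG N r → ℕ) → A) (x y : Spin r) (M : SiteG N r → ℕ) :
    rowOp t z1 L (fun x' M' => stpM t z2 s' (fun y' M'' => H x' y' M'') y M') x M
    = stpM t z2 s' (fun y' M' => rowOp t z1 L (fun x' M'' => H x' y' M'') x M') y M := by
  induction L generalizing x M with
  | nil => rfl
  | cons s L ih =>
    simp only [List.mem_cons, not_or] at h
    simp only [rowOp]
    rw [← stpM_comm t z1 z2 s s' (Ne.symm h.1)]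
    congr 1
    funext x' M'
    exact ih h.2 x' M'

/-- two rows -/
def twoOp (t z1 z2 : A) (L : List (SiteG N r)) (G : Spin r → Spin r → (SiteG N r → ℕ) → A)
    (x y : Spin r) (M : SiteG N r → ℕ) : A :=
  rowOp t z1 L (fun x' M' => rowOp t z2 L (fun y' M'' => G x' y' M'') y M') x M

lemma twoOp_cons (t z1 z2 : A) (s : SiteG N r) (L : List (SiteG N r)) (h : s ∉ L)
    (G : Spin r → Spin r → (SiteG N r → ℕ) → A) (x y : Spin r) (M : SiteG N r → ℕ) :
    twoOp t z1 z2 (s :: L) G x y M =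
    stpM t z1 s (fun x' M' => stpM t z2 s (fun y' M'' => twoOp t z1 z2 L G x' y' M'') y M') x M := by
  simp only [twoOp, rowOp]
  congr 1
  funext x' M'
  exact rowOp_stpM_comm t z1 z2 s L h
    (fun x' y' M'' => rowOp t z2 L (fun y' M'' => G x' y' M'') y' M'') x' y M'

lemma ybe_stpM (t zi zj : A) (s : SiteG N r) (G : Spin r → Spin r → (SiteG N r → ℕ) → A)
    (x y : Spin r) (M : SiteG N r → ℕ) :
    RG t zi zj (alphaG r s.2.1 s.2.2)
      (fun x y => stpM t zi s (fun x' M' => stpM t zj s (fun y' M'' => G x' y' M'') y M') x M) x y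
    = stpM t zj s (fun x' M' => stpM t zi s
        (fun y' M'' => RG t zi zj (alphaG r (s.2.1 + 1) s.2.2) (fun u v => G u v M'') x' y') y M') x M := by
  simp only [stpM, Function.update_self, Function.update_idem]
  exact ybe_step t zi zj s.2.1 s.2.2 (fun x y n => G x y (Function.update M s n)) x y (M s)

/-- intertwining property -/
def YBE (t zi zj : A) (al al' : Spin r → Spin r → ℕ) (L : List (SiteG N r)) : Prop :=
  ∀ (G : Spin r → Spin r → (SiteG N r → ℕ) → A) (x y : Spin r) (M : SiteG N r → ℕ),
    RG t zi zj al (fun x y => twoOp t zi zj L G x y M) x y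
    = twoOp t zj zi L (fun u v M' => RG t zi zj al' (fun u v => G u v M') u v) x y M

lemma YBE_nil (t zi zj : A) (al : Spin r → Spin r → ℕ) :
    YBE t zi zj al al ([] : List (SiteG N r)) := fun _ _ _ _ => rfl

lemma RG_congr (t zi zj : A) (al : Spin r → Spin r → ℕ) (G G' : Spin r → Spin r → A)
    (h : ∀ x y, G x y = G' x y) (x y) : RG t zi zj al G x y = RG t zi zj al G' x y := by
  have : G = G' := by funext x y; exact h x y
  rw [this]

lemma YBE_cons (t zi zj : A) (s : SiteG N r) (L : List (SiteG N r)) (h : s ∉ L)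
    (al' : Spin r → Spin r → ℕ)
    (hL : YBE t zi zj (alphaG r (s.2.1 + 1) s.2.2) al' L) :
    YBE t zi zj (alphaG r s.2.1 s.2.2) al' (s :: L) := by
  intro G x y M
  simp only [twoOp_cons t _ _ s L h]
  rw [ybe_stpM]
  congr 1
  funext x' M'
  congr 1
  funext y' M''
  exact hL G x' y' M''

lemma alphaG_wrap (b : ℕ) (hr : 0 < r) (hb : b < r) :
    alphaG r r b = alphaG r 0 (if b = 0 then r - 1 else b - 1) := by
  funext x y
  rcases x with ⟨e, he⟩ | ⟨e, he⟩ <;> rcases y with ⟨f, hf⟩ | ⟨f, hf⟩ <;>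
    simp only [alphaG] <;> refine if_congr ?_ rfl rfl
  · omega
  · simp [he]
  · simp [hf]
  · simp only [and_true]
    split_ifs <;> omega

/-- the `k`-th boson -/
def bosN (r : ℕ) [NeZero r] (k : ℕ) : Fin r × Fin r :=
  (⟨k % r, Nat.mod_lt _ (Nat.pos_of_neZero r)⟩,
   ⟨r - 1 - k / r, lt_of_le_of_lt (Nat.sub_le _ _)
      (Nat.sub_lt (Nat.pos_of_neZero r) one_pos)⟩)

lemma bosN_inj [NeZero r] {k k' : ℕ} (hk : k < r * r) (hk' : k' < r * r)
    (h : bosN r k = bosN r k') : k = k' := by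
  simp only [bosN, Prod.mk.injEq, Fin.mk.injEq] at h
  have h1 := Nat.div_lt_of_lt_mul hk
  have h2 := Nat.div_lt_of_lt_mul hk'
  have h3 : k / r = k' / r := by omega
  rw [← Nat.div_add_mod k r, ← Nat.div_add_mod k' r, h3, h.1]

/-- sites of a column: `n` sites starting from the `k`-th one -/
def colSites (r : ℕ) [NeZero r] {N : ℕ} (j : Fin N) : ℕ → ℕ → List (SiteG N r)
  | 0, _ => []
  | n + 1, k => (j, bosN r k) :: colSites r j n (k + 1)

lemma mem_colSites [NeZero r] (j : Fin N) (n k : ℕ) (s : SiteG N r) :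
    s ∈ colSites r j n k ↔ ∃ k', k ≤ k' ∧ k' < k + n ∧ s = (j, bosN r k') := by
  induction n generalizing k with
  | zero => simp [colSites]; intros; omega
  | succ n ih =>
    simp only [colSites, List.mem_cons, ih]
    constructor
    · rintro (h | ⟨k', h1, h2, h3⟩)
      · exact ⟨k, le_rfl, by omega, h⟩
      · exact ⟨k', by omega, by omega, h3⟩
    · rintro ⟨k', h1, h2, h3⟩
      rcases Nat.eq_or_lt_of_le h1 with rfl | h
      · exact Or.inl h3
      · exact Or.inr ⟨k', by omega, by omega, h3⟩

lemma not_mem_colSites [NeZero r] (j : Fin N) (n k : ℕ) (h : k + n + 1 ≤ r * r) :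
    (j, bosN r k) ∉ colSites r j n (k + 1) := by
  rw [mem_colSites]
  rintro ⟨k', h1, h2, h3⟩
  have := bosN_inj (by omega) (by omega) (Prod.mk.inj h3).2
  omega

/-- the R-matrix exponent before the `k`-th boson -/
def alphaK (r k : ℕ) : Spin r → Spin r → ℕ :=
  if k < r * r then alphaG r (k % r) (r - 1 - k / r) else alphaG r 0 (r - 1)

lemma alphaK_succ (k : ℕ) (hr : 0 < r) (hk : k < r * r) :
    alphaG r (k % r + 1) (r - 1 - k / r) = alphaK r (k + 1) := by
  have h1 : k % r < r := Nat.mod_lt _ hr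
  have h2 : k / r < r := Nat.div_lt_of_lt_mul hk
  have h3 := Nat.div_add_mod k r
  rcases Nat.lt_or_ge (k % r + 1) r with h | h
  · have hd : (k + 1) / r = k / r := by
      rw [Nat.div_eq_iff hr]
      constructor
      · rw [mul_comm]; omega
      · rw [mul_comm]; omega
    have hm : (k + 1) % r = k % r + 1 := by
      have h4 := Nat.div_add_mod (k + 1) r
      rw [hd] at h4; omega
    have hlt : k + 1 < r * r := by
      have : r * (k / r) + r ≤ r * r := by
        have := Nat.mul_le_mul_left r (show k / r + 1 ≤ r from h2)
        rw [Nat.mul_succ] at this; exact this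
      omega
    simp only [alphaK, hlt, if_true, hd, hm]
  · have hm : k % r + 1 = r := by omega
    have hk1 : k + 1 = r * (k / r + 1) := by rw [Nat.mul_succ]; omega
    rw [hm, alphaG_wrap (r - 1 - k / r) hr (lt_of_le_of_lt (Nat.sub_le _ _) (Nat.sub_lt hr one_pos)), alphaK]
    have hd : (k + 1) / r = k / r + 1 := by rw [hk1, Nat.mul_div_cancel_left _ hr]
    have hmm : (k + 1) % r = 0 := by rw [hk1, Nat.mul_mod_right]
    rw [hd, hmm]
    by_cases hl : k + 1 < r * r
    · have : k / r + 1 < r := by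
        rw [hk1] at hl; exact Nat.lt_of_mul_lt_mul_left hl
      rw [if_pos hl, if_neg (by omega)]
      congr 1
    · have : r * r ≤ r * (k / r + 1) := by omega
      have := Nat.le_of_mul_le_mul_left this hr
      rw [if_neg hl, if_pos (show r - 1 - k / r = 0 by omega)]

lemma YBE_colSites [NeZero r] (t zi zj : A) (j : Fin N) (n k : ℕ) (h : k + n = r * r) :
    YBE t zi zj (alphaK r k) (alphaG r 0 (r - 1)) (colSites r j n k) := by
  have hr := Nat.pos_of_neZero r
  induction n generalizing k with
  | zero =>
    have : ¬ k < r * r := by omega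
    simp only [alphaK, this, if_false, colSites]
    exact YBE_nil _ _ _ _
  | succ n ih =>
    have hk : k < r * r := by omega
    have := ih (k + 1) (by omega)
    rw [← alphaK_succ k hr hk] at this
    have := YBE_cons t zi zj (j, bosN r k) (colSites r j n (k + 1))
      (not_mem_colSites j n k (by omega)) _ this
    rw [alphaK, if_pos hk]
    exact this

lemma twoOp_append (t z1 z2 : A) (L L' : List (SiteG N r)) (h : L.Disjoint L') (hL : L.Nodup)
    (G : Spin r → Spin r → (SiteG N r → ℕ) → A) (x y : Spin r) (M : SiteG N r → ℕ) :
    twoOp t z1 z2 (L ++ L') G x y M = twoOp t z1 z2 L (twoOp t z1 z2 L' G) x y M := by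
  induction L generalizing x y M with
  | nil => rfl
  | cons s L ih =>
    rw [List.nodup_cons] at hL
    rw [List.disjoint_cons_left] at h
    rw [List.cons_append, twoOp_cons, twoOp_cons _ _ _ _ _ hL.1]
    · congr 1
      funext x' M'
      congr 1
      funext y' M''
      exact ih h.2 hL.2 x' y' M''
    · simp [hL.1, h.1]

lemma YBE_append (t zi zj : A) (L L' : List (SiteG N r)) (h : L.Disjoint L') (hL : L.Nodup)
    (al al' al'' : Spin r → Spin r → ℕ) (h1 : YBE t zi zj al al' L)
    (h2 : YBE t zi zj al' al'' L') : YBE t zi zj al al'' (L ++ L') := by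
  intro G x y M
  simp only [twoOp_append _ _ _ _ _ h hL]
  rw [h1]
  congr 1
  funext u v M'
  exact h2 G u v M'

lemma nodup_colSites [NeZero r] (j : Fin N) (n k : ℕ) (h : k + n ≤ r * r) :
    (colSites r j n k).Nodup := by
  induction n generalizing k with
  | zero => simp [colSites]
  | succ n ih =>
    simp only [colSites, List.nodup_cons]
    exact ⟨not_mem_colSites j n k (by omega), ih (k + 1) (by omega)⟩

/-- the `k`-th column from the left -/
def colN (N : ℕ) [NeZero N] (k : ℕ) : Fin N :=
  ⟨N - 1 - k, lt_of_le_of_lt (Nat.sub_le _ _) (Nat.sub_lt (Nat.pos_of_neZero N) one_pos)⟩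

/-- sites of a row : `n` columns starting from the `k`-th one -/
def rowSites (r N : ℕ) [NeZero r] [NeZero N] : ℕ → ℕ → List (SiteG N r)
  | 0, _ => []
  | n + 1, k => colSites r (colN N k) (r * r) 0 ++ rowSites r N n (k + 1)

lemma mem_rowSites [NeZero r] [NeZero N] (n k : ℕ) (s : SiteG N r) (h : s ∈ rowSites r N n k) :
    ∃ k', k ≤ k' ∧ k' < k + n ∧ s.1 = colN N k' := by
  induction n generalizing k with
  | zero => simp [rowSites] at h
  | succ n ih =>
    simp only [rowSites, List.mem_append, mem_colSites] at h
    rcases h with ⟨k', _, _, rfl⟩ | h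
    · exact ⟨k, le_rfl, by omega, rfl⟩
    · obtain ⟨k', h1, h2, h3⟩ := ih _ h
      exact ⟨k', by omega, by omega, h3⟩

lemma colN_notin [NeZero r] [NeZero N] (n k : ℕ) (h : k + n + 1 ≤ N) (s : SiteG N r)
    (hs : s.1 = colN N k) : s ∉ rowSites r N n (k + 1) := by
  intro h'
  obtain ⟨k', h1, h2, h3⟩ := mem_rowSites _ _ _ h'
  rw [hs] at h3
  simp only [colN, Fin.mk.injEq] at h3
  omega

lemma disj_rowSites [NeZero r] [NeZero N] (n k m : ℕ) (h : k + n + 1 ≤ N) :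
    (colSites r (colN N k) m 0).Disjoint (rowSites r N n (k + 1)) := by
  intro s hs
  rw [mem_colSites] at hs
  obtain ⟨k', _, _, rfl⟩ := hs
  exact colN_notin n k h _ rfl

lemma nodup_rowSites [NeZero r] [NeZero N] (n k : ℕ) (h : k + n ≤ N) :
    (rowSites r N n k).Nodup := by
  induction n generalizing k with
  | zero => simp [rowSites]
  | succ n ih =>
    simp only [rowSites, List.nodup_append']
    exact ⟨nodup_colSites _ _ _ (by omega), ih (k + 1) (by omega), disj_rowSites _ _ _ (by omega)⟩

set_option linter.unusedVariables false in
lemma YBE_rowSites [NeZero r] [NeZero N] (t zi zj : A) (n k : ℕ) (h : k + n ≤ N) :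
    YBE t zi zj (alphaG r 0 (r - 1)) (alphaG r 0 (r - 1)) (rowSites r N n k) := by
  induction n generalizing k with
  | zero => exact YBE_nil _ _ _ _
  | succ n ih =>
    refine YBE_append t zi zj _ _ (disj_rowSites _ _ _ (by omega))
      (nodup_colSites _ _ _ (by rw [Nat.zero_add]))
      _ _ _ ?_ (ih (k + 1) (by omega))
    have := YBE_colSites (r := r) t zi zj (colN N k) (r * r) 0 (by omega)
    have h0 : alphaK r 0 = alphaG r 0 (r - 1) := by
      simp [alphaK]
    rwa [h0] at this

lemma stpM_lin (t z c1 c2 : A) (s : SiteG N r) (F1 F2 : Spin r → (SiteG N r → ℕ) → A) (x) (M) :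
    stpM t z s (fun x M => c1 * F1 x M + c2 * F2 x M) x M
      = c1 * stpM t z s F1 x M + c2 * stpM t z s F2 x M := by
  simp only [stpM, stpG]; ring

lemma rowOp_lin (t z c1 c2 : A) (L : List (SiteG N r)) (F1 F2 : Spin r → (SiteG N r → ℕ) → A)
    (x) (M) :
    rowOp t z L (fun x M => c1 * F1 x M + c2 * F2 x M) x M
      = c1 * rowOp t z L F1 x M + c2 * rowOp t z L F2 x M := by
  induction L generalizing x M with
  | nil => rfl
  | cons s L ih =>
    simp only [rowOp]
    rw [← stpM_lin]
    congr 1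
    funext x M
    exact ih x M

lemma stpM_zero (t z : A) (s : SiteG N r) (x) (M) :
    stpM t z s (fun _ _ => 0) x M = 0 := by
  simp only [stpM, stpG]; ring

lemma rowOp_zero (t z : A) (L : List (SiteG N r)) (x) (M) :
    rowOp t z L (fun _ _ => 0) x M = 0 := by
  induction L generalizing x M with
  | nil => rfl
  | cons s L ih =>
    simp only [rowOp]
    have : rowOp t z L (fun _ _ => (0 : A)) = fun _ _ => 0 := by
      funext x M
      exact ih x M
    rw [this, stpM_zero]

lemma rowOp_sum {ι : Type*} (t z : A) (L : List (SiteG N r)) (S : Finset ι) (c : ι → A)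
    (F : ι → Spin r → (SiteG N r → ℕ) → A) (x) (M) :
    rowOp t z L (fun x M => ∑ i ∈ S, c i * F i x M) x M = ∑ i ∈ S, c i * rowOp t z L (F i) x M := by
  classical
  induction S using Finset.induction_on with
  | empty => simp [rowOp_zero]
  | insert i S hi ih =>
    simp only [Finset.sum_insert hi]
    rw [← ih]
    have := rowOp_lin t z (c i) 1 L (F i) (fun x M => ∑ i ∈ S, c i * F i x M) x M
    simpa using this

lemma rowOp_map {B : Type*} [CommRing B] (φ : A →+* B) (t z : A) (L : List (SiteG N r))
    (F : Spin r → (SiteG N r → ℕ) → A) (x) (M) :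
    φ (rowOp t z L F x M) = rowOp (φ t) (φ z) L (fun x M => φ (F x M)) x M := by
  induction L generalizing x M with
  | nil => rfl
  | cons s L ih =>
    simp only [rowOp, stpM, stpG, map_add, map_mul, ih]
    congr 2
    · rcases x with e | e <;> simp only [pwG, apply_ite φ, map_one, map_pow, map_mul]
    · rcases x with e | e <;> simp only [cwG, apply_ite φ, map_sub, map_sum, map_one, map_pow, map_mul, map_zero]

end YBops


section RowSum
variable {A : Type*} [CommRing A] {r N : ℕ}

lemma rowOp_congr (t z : A) (L : List (SiteG N r)) (hL : L.Nodup)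
    (F F' : Spin r → (SiteG N r → ℕ) → A) (x : Spin r) (M : SiteG N r → ℕ)
    (h : ∀ y M', (∀ s, s ∉ L → M' s = M s) → (∀ s, M' s ≤ M s + 1) → F y M' = F' y M') :
    rowOp t z L F x M = rowOp t z L F' x M := by
  induction L generalizing x M with
  | nil => exact h x M (fun _ _ => rfl) (fun _ => Nat.le_succ _)
  | cons s L ih =>
    rw [List.nodup_cons] at hL
    have key : ∀ y n, n ≤ M s + 1 →
        rowOp t z L F y (Function.update M s n) = rowOp t z L F' y (Function.update M s n) := by
      intro y n hn
      refine ih hL.2 y _ fun y' M' h1 h2 => h y' M' ?_ ?_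
      · intro s' hs'
        simp only [List.mem_cons, not_or] at hs'
        rw [h1 s' hs'.2, Function.update_of_ne hs'.1]
      · intro s'
        by_cases hs : s' = s
        · subst hs
          rw [h1 s' hL.1, Function.update_self]; exact hn
        · have := h2 s'
          rwa [Function.update_of_ne hs] at this
    simp only [rowOp, stpM, stpG]
    rw [key _ _ (Nat.le_succ _), key _ _ (by rcases x with e | e <;> simp only [cnG] <;> omega)]

/-- weight of a step with prescribed multiplicities -/
def stwG (t z : A) (ab : Fin r × Fin r) (n n' : ℕ) (x : Spin r) : A :=
  if n' = n then pwG t z ab n x else if n' = cnG x n then cwG t z ab n x else 0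

/-- next spin with prescribed multiplicities -/
def nxS (ab : Fin r × Fin r) (n n' : ℕ) (x : Spin r) : Spin r :=
  if n = n' + 1 then Sum.inl ab.1 else if n' = n + 1 then Sum.inr ab.2 else x

/-- final spin along a list of sites -/
def spL (M M' : SiteG N r → ℕ) : List (SiteG N r) → Spin r → Spin r
  | [], x => x
  | s :: L, x => spL M M' L (nxS s.2 (M s) (M' s) x)

/-- weight along a list of sites -/
def wtL (t z : A) (M M' : SiteG N r → ℕ) : List (SiteG N r) → Spin r → A
  | [], _ => 1
  | s :: L, x => stwG t z s.2 (M s) (M' s) x * wtL t z M M' L (nxS s.2 (M s) (M' s) x)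

lemma spL_append (M M' : SiteG N r → ℕ) (L L' : List (SiteG N r)) (x : Spin r) :
    spL M M' (L ++ L') x = spL M M' L' (spL M M' L x) := by
  induction L generalizing x with
  | nil => rfl
  | cons s L ih => simp only [List.cons_append, spL, ih]

lemma wtL_append (t z : A) (M M' : SiteG N r → ℕ) (L L' : List (SiteG N r)) (x : Spin r) :
    wtL t z M M' (L ++ L') x = wtL t z M M' L x * wtL t z M M' L' (spL M M' L x) := by
  induction L generalizing x with
  | nil => simp [wtL, spL]
  | cons s L ih => simp only [List.cons_append, wtL, spL, ih, mul_assoc]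

lemma spL_congr (M1 M M' : SiteG N r → ℕ) (L : List (SiteG N r)) (h : ∀ s ∈ L, M1 s = M s)
    (x : Spin r) : spL M1 M' L x = spL M M' L x := by
  induction L generalizing x with
  | nil => rfl
  | cons s L ih =>
    simp only [spL, h s (by simp)]
    exact ih (fun s hs => h s (by simp [hs])) _

lemma wtL_congr (t z : A) (M1 M M' : SiteG N r → ℕ) (L : List (SiteG N r))
    (h : ∀ s ∈ L, M1 s = M s) (x : Spin r) : wtL t z M1 M' L x = wtL t z M M' L x := by
  induction L generalizing x with
  | nil => rfl
  | cons s L ih =>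
    simp only [wtL, h s (by simp)]
    rw [ih (fun s hs => h s (by simp [hs]))]

open Classical in
lemma rowOp_delta (t z : A) (L : List (SiteG N r)) (hL : L.Nodup) (f : Spin r → A)
    (M' : SiteG N r → ℕ) (x : Spin r) (M : SiteG N r → ℕ) :
    rowOp t z L (fun y M'' => if M'' = M' then f y else 0) x M
      = if (∀ s, s ∉ L → M s = M' s) then wtL t z M M' L x * f (spL M M' L x) else 0 := by
  induction L generalizing x M with
  | nil => simp [rowOp, wtL, spL, funext_iff]
  | cons s L ih =>
    rw [List.nodup_cons] at hL
    have key : ∀ y n, rowOp t z L (fun y M'' => if M'' = M' then f y else 0) y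
        (Function.update M s n) = if M' s = n then
          (if (∀ s', s' ∉ s :: L → M s' = M' s') then wtL t z M M' L y * f (spL M M' L y) else 0)
          else 0 := by
      intro y n
      rw [ih hL.2]
      have hu : ∀ s' ∈ L, Function.update M s n s' = M s' := fun s' hs' =>
        Function.update_of_ne (fun h : s' = s => hL.1 (h ▸ hs')) _ _
      rw [wtL_congr t z _ M M' L hu, spL_congr _ M M' L hu, ← ite_and]
      refine if_congr ?_ rfl rfl
      constructor
      · intro h
        refine ⟨?_, ?_⟩
        · have := h s hL.1
          rw [Function.update_self] at this; exact this.symm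
        · intro s' hs'
          simp only [List.mem_cons, not_or] at hs'
          have := h s' hs'.2
          rwa [Function.update_of_ne hs'.1] at this
      · rintro ⟨h1, h2⟩ s' hs'
        by_cases hs : s' = s
        · subst hs
          rw [Function.update_self, h1]
        · rw [Function.update_of_ne hs]
          exact h2 s' (by simp [hs, hs'])
    simp only [rowOp, stpM, stpG]
    rw [key, key]
    by_cases hC : ∀ s', s' ∉ s :: L → M s' = M' s'
    swap
    · simp only [if_neg hC, ite_self, mul_zero, add_zero]
    simp only [if_pos hC, wtL, spL]
    by_cases h1 : M' s = M s
    · have hn : nxS s.2 (M s) (M' s) x = x := by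
        simp only [nxS]; rw [if_neg (by omega), if_neg (by omega)]
      rw [if_pos h1, hn, stwG, if_pos h1]
      have : cwG t z s.2 (M s) x * (if M' s = cnG x (M s) then
          wtL t z M M' L (cxG s.2 x) * f (spL M M' L (cxG s.2 x)) else 0) = 0 := by
        split_ifs with h2
        · rcases x with e | e
          · simp only [cnG] at h2; omega
          · have : M s = 0 := by simp only [cnG] at h2; omega
            simp [cwG, this]
        · simp
      rw [this]; ring
    · rw [if_neg h1, stwG, if_neg h1]
      split_ifs with h2
      · have : nxS s.2 (M s) (M' s) x = cxG s.2 x := by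
          rcases x with e | e <;> simp only [cnG] at h2
          · simp only [nxS, cxG]; rw [if_neg (by omega), if_pos (by omega)]
          · simp only [nxS, cxG]; rw [if_pos (by omega)]
        rw [this]; ring
      · simp

lemma bosN_surj [NeZero r] (ab : Fin r × Fin r) : ∃ k, k < r * r ∧ bosN r k = ab := by
  obtain ⟨⟨a, ha⟩, ⟨b, hb⟩⟩ := ab
  have hr := Nat.pos_of_neZero r
  refine ⟨a + r * (r - 1 - b), ?_, ?_⟩
  · have : r * (r - 1 - b) ≤ r * (r - 1) := Nat.mul_le_mul_left _ (Nat.sub_le _ _)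
    have h2 : r * (r - 1) + r = r * r := by
      rw [← Nat.mul_succ, Nat.succ_eq_add_one, Nat.sub_add_cancel hr]
    omega
  · simp only [bosN, Prod.mk.injEq, Fin.mk.injEq]
    rw [Nat.add_mul_mod_self_left, Nat.mod_eq_of_lt ha, Nat.add_mul_div_left _ _ hr,
      Nat.div_eq_of_lt ha]
    omega

lemma rowSites_snoc [NeZero r] [NeZero N] (n k : ℕ) :
    rowSites r N (n + 1) k = rowSites r N n k ++ colSites r (colN N (k + n)) (r * r) 0 := by
  induction n generalizing k with
  | zero => simp [rowSites]
  | succ n ih =>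
    rw [rowSites, ih, rowSites, List.append_assoc, show k + 1 + n = k + (n + 1) by omega]

lemma colSites_sub_row [NeZero r] [NeZero N] (n k k' : ℕ) (h1 : k ≤ k') (h2 : k' < k + n)
    (s : SiteG N r) (hs : s ∈ colSites r (colN N k') (r * r) 0) : s ∈ rowSites r N n k := by
  induction n generalizing k with
  | zero => omega
  | succ n ih =>
    rw [rowSites, List.mem_append]
    rcases Nat.eq_or_lt_of_le h1 with rfl | h
    · exact Or.inl hs
    · exact Or.inr (ih (k + 1) (by omega) (by omega))

lemma mem_rowSites_full [NeZero r] [NeZero N] (s : SiteG N r) : s ∈ rowSites r N N 0 := by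
  obtain ⟨j, ab⟩ := s
  have hj := j.2
  obtain ⟨k, hk, rfl⟩ := bosN_surj ab
  refine colSites_sub_row N 0 (N - 1 - j.val) (by omega) (by omega) _ ?_
  have : colN N (N - 1 - j.val) = j := by
    simp only [colN, Fin.ext_iff]; omega
  rw [this, mem_colSites]
  exact ⟨k, by omega, by omega, rfl⟩

/-- bounded configurations -/
def boxN (r N B : ℕ) : Finset (SiteG N r → ℕ) :=
  Fintype.piFinset fun _ => Finset.range (B + 1)

lemma mem_boxN (B : ℕ) (M : SiteG N r → ℕ) : M ∈ boxN r N B ↔ ∀ s, M s ≤ B := by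
  simp [boxN, Fintype.mem_piFinset]

lemma rowOp_box [NeZero r] [NeZero N] (t z : A) (F : Spin r → (SiteG N r → ℕ) → A) (x : Spin r)
    (B : ℕ) (M : SiteG N r → ℕ) (hM : M ∈ boxN r N B) :
    rowOp t z (rowSites r N N 0) F x M = ∑ M' ∈ boxN r N (B + 1),
      wtL t z M M' (rowSites r N N 0) x * F (spL M M' (rowSites r N N 0) x) M' := by
  classical
  have hnd := nodup_rowSites (r := r) (N := N) N 0 (by omega)
  rw [mem_boxN] at hM
  rw [rowOp_congr t z _ hnd F
    (fun y M'' => ∑ M' ∈ boxN r N (B + 1), 1 * (if M'' = M' then F y M' else 0))]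
  · rw [rowOp_sum]
    refine Finset.sum_congr rfl fun M' _ => ?_
    rw [rowOp_delta t z _ hnd (fun y => F y M'), if_pos, one_mul]
    intro s hs
    exact absurd (mem_rowSites_full s) hs
  · intro y M'' _ h2
    have : M'' ∈ boxN r N (B + 1) := by
      rw [mem_boxN]; intro s; exact (h2 s).trans (Nat.succ_le_succ (hM s))
    simp [this]

/-- recursive partition function -/
def Zrec [NeZero r] [NeZero N] (t : A) (z : ℕ → A) (l rr : ℕ → Spin r) :
    ℕ → ℕ → (SiteG N r → ℕ) → A
  | 0, _, M => by classical exact if M = 0 then 1 else 0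
  | n + 1, k, M => rowOp t (z k) (rowSites r N N 0)
      (fun x M' => if x = rr k then Zrec t z l rr n (k + 1) M' else 0) (l k) M

lemma path_sum {C : Type*} (S : ℕ → Finset C) (w : ℕ → C → C → A) (V : ℕ → ℕ → C → A) (e : C → A)
    (h0 : ∀ k x, V 0 k x = e x)
    (h1 : ∀ n k x, x ∈ S k → V (n + 1) k x = ∑ y ∈ S (k + 1), w k x y * V n (k + 1) y)
    (n k : ℕ) (x : C) (hx : x ∈ S k) :
    V n k x = ∑ P ∈ Fintype.piFinset (fun i : Fin n => S (k + i.val + 1)),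
      (∏ i : Fin n, w (k + i.val) ((Fin.cons x P : Fin (n + 1) → C) i.castSucc)
        ((Fin.cons x P : Fin (n + 1) → C) i.succ)) *
        e ((Fin.cons x P : Fin (n + 1) → C) (Fin.last n)) := by
  induction n generalizing k x with
  | zero => 
    simp [h0, Fin.last]
  | succ n ih =>
    rw [h1 n k x hx]
    have : ∀ y ∈ S (k + 1), w k x y * V n (k + 1) y = ∑ P ∈ Fintype.piFinset
        (fun i : Fin n => S (k + 1 + i.val + 1)), w k x y *
        ((∏ i : Fin n, w (k + 1 + i.val) ((Fin.cons y P : Fin (n + 1) → C) i.castSucc)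
        ((Fin.cons y P : Fin (n + 1) → C) i.succ)) *
        e ((Fin.cons y P : Fin (n + 1) → C) (Fin.last n))) := by
      intro y hy
      rw [ih (k + 1) y hy, Finset.mul_sum]
    rw [Finset.sum_congr rfl this, ← Finset.sum_product']
    refine Finset.sum_nbij' (fun p => (Fin.cons p.1 p.2 : Fin (n + 1) → C))
      (fun h => (h 0, Fin.tail h)) ?_ ?_ ?_ ?_ ?_
    · rintro ⟨y, P⟩ h
      simp only [Finset.mem_product, Fintype.mem_piFinset] at h ⊢
      rw [Fin.forall_fin_succ]
      refine ⟨by simpa using h.1, fun i => ?_⟩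
      have := h.2 i
      simp only [Fin.cons_succ, Fin.val_succ]
      rwa [show k + (i.val + 1) + 1 = k + 1 + i.val + 1 by omega]
    · intro h hh
      simp only [Finset.mem_product, Fintype.mem_piFinset] at hh ⊢
      refine ⟨by simpa using hh 0, fun i => ?_⟩
      have := hh i.succ
      simp only [Fin.val_succ] at this
      rwa [show k + (i.val + 1) + 1 = k + 1 + i.val + 1 by omega] at this
    · rintro ⟨y, P⟩ _
      simp
    · intro h _
      simp
    · rintro ⟨y, P⟩ _
      simp only [Fin.prod_univ_succ (n := n)]
      simp only [Fin.castSucc_zero, Fin.cons_zero, Fin.cons_succ, Fin.val_zero, add_zero,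
        Fin.val_succ, ← Fin.succ_castSucc, ← Fin.succ_last, mul_assoc]
      congr 2
      refine Finset.prod_congr rfl fun i _ => ?_
      rw [show k + (i.val + 1) = k + 1 + i.val by omega]

end RowSum


section Connect
variable {r N : ℕ}

/-- validity of a step -/
def VStep (ab : Fin r × Fin r) (n n' : ℕ) (x : Spin r) : Prop :=
  n' = n ∨ (x = Sum.inr ab.2 ∧ n = n' + 1) ∨ (x = Sum.inl ab.1 ∧ n' = n + 1)

open Classical in
lemma stwG_eq (z : PolyR r) (ab : Fin r × Fin r) (n n' : ℕ) (x : Spin r) :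
    stwG (tP r) z ab n n' x = if VStep ab n n' x then stepWeight z n n' ab x else 0 := by
  by_cases h : n' = n
  · subst h
    have hv : VStep ab n' n' x := Or.inl rfl
    rw [if_pos hv, stwG, if_pos rfl, stepWeight, if_neg (by omega), if_neg (by omega),
      min_self]
    rcases x with e | e <;> rfl
  · rw [stwG, if_neg h]
    rcases x with e | e
    · have hc : cnG (Sum.inl e : Spin r) n = n + 1 := rfl
      rw [hc, cwG]
      by_cases h2 : n' = n + 1
      · rw [if_pos h2]
        by_cases h3 : e = ab.1
        · rw [if_pos h3, if_pos (show VStep _ _ _ _ from Or.inr (Or.inr ⟨by rw [h3], h2⟩)), stepWeight, if_neg (by omega),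
            if_pos h2]
        · rw [if_neg h3, if_neg]
          rintro (h4 | ⟨h4, _⟩ | ⟨h4, _⟩)
          · exact h h4
          · cases h4
          · exact h3 (Sum.inl.inj h4)
      · rw [if_neg h2, if_neg]
        rintro (h4 | ⟨h4, _⟩ | ⟨_, h4⟩)
        · exact h h4
        · cases h4
        · exact h2 h4
    · have hc : cnG (Sum.inr e : Spin r) n = n - 1 := rfl
      rw [hc, cwG]
      by_cases h2 : n = n' + 1
      · rw [if_pos (show n' = n - 1 by omega)]
        by_cases h3 : e = ab.2
        · rw [if_pos h3, if_pos (show VStep _ _ _ _ from Or.inr (Or.inl ⟨by rw [h3], h2⟩)), stepWeight, if_pos h2,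
            show min n n' + 1 = n by omega]
        · rw [if_neg h3, if_neg]
          rintro (h4 | ⟨h4, _⟩ | ⟨h4, _⟩)
          · exact h h4
          · exact h3 (Sum.inr.inj h4)
          · cases h4
      · rw [if_neg (show ¬ n' = n - 1 by omega), if_neg]
        rintro (h4 | ⟨_, h4⟩ | ⟨h4, _⟩)
        · exact h h4
        · exact h2 h4
        · cases h4

lemma bosonOfIdx_eq [NeZero r] (k : Fin (r * r)) : bosonOfIdx k = bosN r k.val := rfl

lemma pathSpin_succ [NeZero r] (m m' : Fin r × Fin r → ℕ) (l : Spin r) (k : ℕ) (hk : k < r * r) :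
    pathSpin m m' l (k + 1) =
      nxS (bosN r k) (m (bosN r k)) (m' (bosN r k)) (pathSpin m m' l k) := by
  rw [pathSpin, dif_pos hk]; rfl

lemma stepOK_iff (m m' : Fin r × Fin r → ℕ) (ab : Fin r × Fin r) (x y : Spin r) :
    StepOK m m' ab x y ↔ VStep ab (m ab) (m' ab) x ∧ y = nxS ab (m ab) (m' ab) x := by
  constructor
  · rintro (⟨h1, h2⟩ | ⟨h1, h2, h3⟩ | ⟨h1, h2, h3⟩)
    · refine ⟨Or.inl h2, ?_⟩
      rw [nxS, if_neg (by omega), if_neg (by omega), h1]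
    · refine ⟨Or.inr (Or.inl ⟨h1, h3⟩), ?_⟩
      rw [nxS, if_pos h3, h2]
    · refine ⟨Or.inr (Or.inr ⟨h1, h3⟩), ?_⟩
      rw [nxS, if_neg (by omega), if_pos h3, h2]
  · rintro ⟨h | ⟨h1, h2⟩ | ⟨h1, h2⟩, h3⟩
    · refine Or.inl ⟨?_, h⟩
      rw [h3, nxS, if_neg (by omega), if_neg (by omega)]
    · refine Or.inr (Or.inl ⟨h1, ?_, h2⟩)
      rw [h3, nxS, if_pos h2]
    · refine Or.inr (Or.inr ⟨h1, ?_, h2⟩)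
      rw [h3, nxS, if_neg (by omega), if_pos h2]

lemma adm_iff [NeZero r] (m m' : Fin r × Fin r → ℕ) (l rr : Spin r) :
    AdmissibleVertex l m rr m' ↔
      (∀ k, k < r * r → VStep (bosN r k) (m (bosN r k)) (m' (bosN r k)) (pathSpin m m' l k)) ∧
      pathSpin m m' l (r * r) = rr := by
  constructor
  · rintro ⟨x, h0, h1, h2⟩
    have hx : ∀ k (hk : k < r * r + 1), x ⟨k, hk⟩ = pathSpin m m' l k := by
      intro k
      induction k with
      | zero => intro hk; rw [pathSpin, ← h0]; rfl
      | succ k ih =>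
        intro hk
        have hk' : k < r * r := by omega
        have := ((stepOK_iff _ _ _ _ _).1 (h2 ⟨k, hk'⟩)).2
        rw [pathSpin_succ _ _ _ _ hk', ← ih (by omega)]
        exact this
    refine ⟨fun k hk => ?_, ?_⟩
    · have := ((stepOK_iff _ _ _ _ _).1 (h2 ⟨k, hk⟩)).1
      rw [← hx k (by omega)]
      exact this
    · rw [← hx _ (by omega), ← h1]; rfl
  · rintro ⟨h1, h2⟩
    refine ⟨fun k => pathSpin m m' l k.val, rfl, h2, fun k => ?_⟩
    rw [stepOK_iff]
    exact ⟨h1 k.val k.2, pathSpin_succ m m' l k.val k.2⟩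

lemma spL_col [NeZero r] (M M' : SiteG N r → ℕ) (j : Fin N) (l : Spin r) (n k : ℕ)
    (h : k + n ≤ r * r) :
    spL M M' (colSites r j n k) (pathSpin (fun ab => M (j, ab)) (fun ab => M' (j, ab)) l k)
      = pathSpin (fun ab => M (j, ab)) (fun ab => M' (j, ab)) l (k + n) := by
  induction n generalizing k with
  | zero => rfl
  | succ n ih =>
    have := ih (k + 1) (by omega)
    rw [pathSpin_succ _ _ _ _ (by omega)] at this
    rw [colSites, spL, show k + (n + 1) = k + 1 + n by omega, ← this]

lemma wtL_col_aux [NeZero r] (z : PolyR r) (M M' : SiteG N r → ℕ) (j : Fin N) (l : Spin r)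
    (n k : ℕ) (h : k + n ≤ r * r) :
    wtL (tP r) z M M' (colSites r j n k)
        (pathSpin (fun ab => M (j, ab)) (fun ab => M' (j, ab)) l k)
      = ∏ i ∈ Finset.range n, stwG (tP r) z (bosN r (k + i)) (M (j, bosN r (k + i)))
        (M' (j, bosN r (k + i)))
        (pathSpin (fun ab => M (j, ab)) (fun ab => M' (j, ab)) l (k + i)) := by
  induction n generalizing k with
  | zero => rfl
  | succ n ih =>
    have := ih (k + 1) (by omega)
    rw [pathSpin_succ _ _ _ _ (by omega)] at this
    rw [colSites, wtL, Finset.prod_range_succ', mul_comm]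
    congr 1
    rw [this]
    refine Finset.prod_congr rfl fun i _ => ?_
    rw [show k + 1 + i = k + (i + 1) by omega]

/-- all steps at the vertex in column `j` are valid -/
def VAdm [NeZero r] (M M' : SiteG N r → ℕ) (j : Fin N) (l : Spin r) : Prop :=
  ∀ k, k < r * r → VStep (bosN r k) (M (j, bosN r k)) (M' (j, bosN r k))
    (pathSpin (fun ab => M (j, ab)) (fun ab => M' (j, ab)) l k)

lemma adm_iff' [NeZero r] (M M' : SiteG N r → ℕ) (j : Fin N) (l rr : Spin r) :
    AdmissibleVertex l (fun ab => M (j, ab)) rr (fun ab => M' (j, ab)) ↔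
      VAdm M M' j l ∧ spL M M' (colSites r j (r * r) 0) l = rr := by
  rw [adm_iff]
  have := spL_col M M' j l (r * r) 0 (by omega)
  rw [Nat.zero_add] at this
  rw [← this]
  rfl

open Classical in
lemma wtL_col [NeZero r] (z : PolyR r) (M M' : SiteG N r → ℕ) (j : Fin N) (l : Spin r) :
    wtL (tP r) z M M' (colSites r j (r * r) 0) l
      = if VAdm M M' j l then vertexWeight z l (fun ab => M (j, ab)) (fun ab => M' (j, ab))
        else 0 := by
  have := wtL_col_aux z M M' j l (r * r) 0 (by omega)
  simp only [Nat.zero_add, stwG_eq] at this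
  rw [pathSpin] at this
  rw [this]
  by_cases h : VAdm M M' j l
  · rw [if_pos h, vertexWeight, Finset.prod_range]
    refine Finset.prod_congr rfl fun k _ => ?_
    rw [if_pos (h k.val k.2)]
    rfl
  · rw [if_neg h]
    simp only [VAdm, not_forall] at h
    obtain ⟨k, hk, h⟩ := h
    exact Finset.prod_eq_zero (Finset.mem_range.2 hk) (if_neg h)

lemma wtL_row [NeZero r] [NeZero N] (z : PolyR r) (M M' : SiteG N r → ℕ) (l : Spin r) (n : ℕ) :
    wtL (tP r) z M M' (rowSites r N n 0) l = ∏ k ∈ Finset.range n,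
      wtL (tP r) z M M' (colSites r (colN N k) (r * r) 0) (spL M M' (rowSites r N k 0) l) := by
  induction n with
  | zero => rfl
  | succ n ih =>
    rw [rowSites_snoc, wtL_append, ih, Finset.prod_range_succ, Nat.zero_add]

/-- the spin on the horizontal edge right of column `p` -/
def hdet [NeZero r] [NeZero N] (M M' : SiteG N r → ℕ) (l : Spin r) (p : ℕ) : Spin r :=
  spL M M' (rowSites r N (N - p) 0) l

lemma hdet_step [NeZero r] [NeZero N] (M M' : SiteG N r → ℕ) (l : Spin r) (j : Fin N) :
    hdet M M' l j.val = spL M M' (colSites r j (r * r) 0) (hdet M M' l (j.val + 1)) := by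
  have hj := j.2
  rw [hdet, hdet, show N - j.val = (N - (j.val + 1)) + 1 by omega, rowSites_snoc, spL_append]
  congr 2
  simp only [colN, Fin.ext_iff]; omega

lemma wtL_row' [NeZero r] [NeZero N] (z : PolyR r) (M M' : SiteG N r → ℕ) (l : Spin r) :
    wtL (tP r) z M M' (rowSites r N N 0) l = ∏ j : Fin N,
      wtL (tP r) z M M' (colSites r j (r * r) 0) (hdet M M' l (j.val + 1)) := by
  rw [wtL_row, Finset.prod_range, ← Equiv.prod_comp Fin.revPerm]
  refine Finset.prod_congr rfl fun j _ => ?_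
  have hj := j.2
  have h1 : colN N (Fin.revPerm j).val = j := by
    simp only [colN, Fin.ext_iff, Fin.revPerm_apply, Fin.val_rev]; omega
  have h2 : (Fin.revPerm j).val = N - (j.val + 1) := by
    simp only [Fin.revPerm_apply, Fin.val_rev]
  rw [h1, hdet, h2]

/-- weight of a row -/
noncomputable def wRow [NeZero r] [NeZero N] (z : ℕ → PolyR r) (l rr : ℕ → Spin r) (k : ℕ)
    (M M' : SiteG N r → ℕ) : PolyR r :=
  if spL M M' (rowSites r N N 0) (l k) = rr k then
    wtL (tP r) (z k) M M' (rowSites r N N 0) (l k) else 0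

open Classical in
/-- final indicator -/
noncomputable def eEnd (M : SiteG N r → ℕ) : PolyR r := if M = 0 then 1 else 0

lemma Zrec_sum [NeZero r] [NeZero N] (z : ℕ → PolyR r) (l rr : ℕ → Spin r) (n k : ℕ)
    (M : SiteG N r → ℕ) (hM : M ∈ boxN r N (r + k)) :
    Zrec (tP r) z l rr n k M =
      ∑ P ∈ Fintype.piFinset (fun i : Fin n => boxN r N (r + (k + i.val + 1))),
      (∏ i : Fin n, wRow z l rr (k + i.val)
        ((Fin.cons M P : Fin (n + 1) → (SiteG N r → ℕ)) i.castSucc)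
        ((Fin.cons M P : Fin (n + 1) → (SiteG N r → ℕ)) i.succ)) *
        eEnd ((Fin.cons M P : Fin (n + 1) → (SiteG N r → ℕ)) (Fin.last n)) := by
  refine path_sum (fun k => boxN r N (r + k)) (wRow z l rr) (Zrec (tP r) z l rr) eEnd
    (fun k x => rfl) ?_ n k M hM
  intro n k x hx
  rw [Zrec, rowOp_box _ _ _ _ _ _ hx]
  refine Finset.sum_congr rfl fun y _ => ?_
  simp only [wRow]
  split_ifs <;> simp

end Connect


section PartZ
variable {r N : ℕ}

/-- the filling determined by its vertical edges and the left boundary -/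
def PhiF [NeZero r] [NeZero N] (l : ℕ → Spin r) (Q : Fin (r + 1) → SiteG N r → ℕ) :
    Filling r N :=
  ⟨fun i j ab => Q i (j, ab), fun i p => hdet (Q i.castSucc) (Q i.succ) (l i.val) p.val⟩

/-- top boundary -/
def topM (N : ℕ) (lam : Fin r → ℕ) (w3 w4 : Equiv.Perm (Fin r)) (s : SiteG N r) : ℕ :=
  (Finset.univ.filter fun i : Fin r =>
    lam i = s.1.val ∧ w3⁻¹ i = s.2.1 ∧ w4⁻¹ (Fin.rev i) = s.2.2).card

lemma topM_mem (lam : Fin r → ℕ) (w3 w4 : Equiv.Perm (Fin r)) :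
    topM N lam w3 w4 ∈ boxN r N (r + 0) := by
  rw [mem_boxN]
  intro s
  refine (Finset.card_le_univ _).trans ?_
  simp

open Classical in
lemma wRow_eq [NeZero r] [NeZero N] (z : ℕ → PolyR r) (l rr : ℕ → Spin r) (k : ℕ)
    (M M' : SiteG N r → ℕ) :
    wRow z l rr k M M' = if hdet M M' (l k) 0 = rr k ∧
      ∀ j : Fin N, VAdm M M' j (hdet M M' (l k) (j.val + 1)) then
      ∏ j : Fin N, vertexWeight (z k) (hdet M M' (l k) (j.val + 1)) (fun ab => M (j, ab))
        (fun ab => M' (j, ab)) else 0 := by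
  have h0 : hdet M M' (l k) 0 = spL M M' (rowSites r N N 0) (l k) := rfl
  rw [wRow, ite_and, h0, wtL_row']
  simp only [wtL_col]
  rw [Finset.prod_ite_zero]
  simp

lemma hdet_last [NeZero r] [NeZero N] (M M' : SiteG N r → ℕ) (l : Spin r) :
    hdet M M' l N = l := by
  rw [hdet, Nat.sub_self]; rfl

/-- left boundary -/
def lB [NeZero r] (w2 : Equiv.Perm (Fin r)) (k : ℕ) : Spin r := Sum.inr (w2⁻¹ (Fin.ofNat r k))

/-- right boundary -/
def rB [NeZero r] (w1 : Equiv.Perm (Fin r)) (k : ℕ) : Spin r := Sum.inl (w1⁻¹ (Fin.ofNat r k))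

/-- row parameters -/
noncomputable def zB (r : ℕ) [NeZero r] (k : ℕ) : PolyR r := zP (Fin.ofNat r k)

lemma ofNat_val [NeZero r] (i : Fin r) : Fin.ofNat r i.val = i := by
  apply Fin.ext
  simp [Fin.ofNat, Nat.mod_eq_of_lt i.2]

lemma inSystem_Phi [NeZero r] [NeZero N] (lam : Fin r → ℕ) (w1 w2 w3 w4 : Equiv.Perm (Fin r))
    (Q : Fin (r + 1) → SiteG N r → ℕ) (h0 : Q 0 = topM N lam w3 w4) :
    InSystem lam w1 w2 w3 w4 (PhiF (lB w2) Q) ↔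
      (∀ i : Fin r, hdet (Q i.castSucc) (Q i.succ) (lB w2 i.val) 0 = rB w1 i.val ∧
        ∀ j : Fin N, VAdm (Q i.castSucc) (Q i.succ) j
          (hdet (Q i.castSucc) (Q i.succ) (lB w2 i.val) (j.val + 1))) ∧ Q (Fin.last r) = 0 := by
  constructor
  · rintro ⟨h1, -, h3, h4, -⟩
    refine ⟨fun i => ⟨?_, fun j => ?_⟩, ?_⟩
    · have := h4 i
      rw [rB, ofNat_val]
      exact this
    · exact ((adm_iff' _ _ _ _ _).1 (h1 i j)).1
    · funext s
      exact h3 s.1 s.2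
  · rintro ⟨h1, h2⟩
    refine ⟨fun i j => (adm_iff' _ _ _ _ _).2 ⟨(h1 i).2 j, ?_⟩, ?_, ?_, ?_, ?_⟩
    · exact (hdet_step _ _ _ _).symm
    · intro j a b
      show Q 0 (j, (a, b)) = _
      rw [h0]; rfl
    · intro j ab
      show Q (Fin.last r) (j, ab) = 0
      rw [h2]; rfl
    · intro i
      have := (h1 i).1
      rw [rB, ofNat_val] at this
      exact this
    · intro i
      show hdet _ _ _ N = _
      rw [hdet_last, lB, ofNat_val]

lemma box_of_state [NeZero r] [NeZero N] (f : Filling r N) (hf : f.IsState)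
    (h0 : ∀ j ab, f.m 0 j ab ≤ r) (n : ℕ) (hn : n < r + 1) (j : Fin N) (ab : Fin r × Fin r) :
    f.m ⟨n, hn⟩ j ab ≤ r + n := by
  induction n with
  | zero => exact h0 j ab
  | succ n ih =>
    have h1 := hf ⟨n, by omega⟩ j
    rw [adm_iff] at h1
    obtain ⟨k, hk, rfl⟩ := bosN_surj ab
    have h2 := h1.1 k hk
    have h3 := ih (by omega)
    have h4 : f.m ⟨n + 1, hn⟩ j (bosN r k) ≤ f.m ⟨n, by omega⟩ j (bosN r k) + 1 := by
      rcases h2 with h | ⟨_, h⟩ | ⟨_, h⟩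
      · exact (le_of_eq h).trans (Nat.le_succ _)
      · have : f.m ⟨n, by omega⟩ j (bosN r k) = f.m ⟨n + 1, hn⟩ j (bosN r k) + 1 := h
        omega
      · exact le_of_eq h
    omega

lemma h_of_state [NeZero r] [NeZero N] (f : Filling r N) (hf : f.IsState) (l : ℕ → Spin r)
    (Q : Fin (r + 1) → SiteG N r → ℕ) (hQ : ∀ i j ab, Q i (j, ab) = f.m i j ab)
    (hl : ∀ i : Fin r, f.h i (Fin.last N) = l i.val) (i : Fin r) (p : ℕ) (hp : p ≤ N) :
    f.h i ⟨N - p, by omega⟩ = hdet (Q i.castSucc) (Q i.succ) (l i.val) (N - p) := by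
  induction p with
  | zero =>
    have := hdet_last (Q i.castSucc) (Q i.succ) (l i.val)
    exact (hl i).trans this.symm
  | succ p ih =>
    have h1 := ih (by omega)
    have h2 := hf i ⟨N - (p + 1), by omega⟩
    have e1 : f.m i.castSucc ⟨N - (p + 1), by omega⟩ =
      fun ab => Q i.castSucc (⟨N - (p + 1), by omega⟩, ab) := by funext ab; rw [hQ]
    have e2 : f.m i.succ ⟨N - (p + 1), by omega⟩ =
      fun ab => Q i.succ (⟨N - (p + 1), by omega⟩, ab) := by funext ab; rw [hQ]
    rw [e1, e2, adm_iff'] at h2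
    have h3 := hdet_step (Q i.castSucc) (Q i.succ) (l i.val) ⟨N - (p + 1), by omega⟩
    have e3 : (Fin.succ ⟨N - (p + 1), by omega⟩ : Fin (N + 1)) = ⟨N - p, by omega⟩ := by
      apply Fin.ext; simp only [Fin.succ_mk]; omega
    rw [e3, h1] at h2
    have e4 : N - (p + 1) + 1 = N - p := by omega
    simp only [e4] at h3
    rw [h3, h2.2]
    rfl

lemma Filling_ext (f g : Filling r N) (h1 : f.m = g.m) (h2 : f.h = g.h) : f = g := by
  cases f; cases g; simp_all

theorem partitionZ_eq [NeZero r] [NeZero N] (lam : Fin r → ℕ) (w1 w2 w3 w4 : Equiv.Perm (Fin r)) :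
    partitionZ r N lam w1 w2 w3 w4 =
      Zrec (tP r) (zB r) (lB w2) (rB w1) r 0 (topM N lam w3 w4) := by
  classical
  set M0 := topM N lam w3 w4 with hM0
  rw [Zrec_sum _ _ _ _ _ _ (topM_mem lam w3 w4), partitionZ,
    finsum_eq_sum_of_support_subset (s := (Fintype.piFinset
      (fun i : Fin r => boxN r N (r + (0 + i.val + 1)))).image
      (fun P => PhiF (lB w2) (Fin.cons M0 P : Fin (r + 1) → (SiteG N r → ℕ)))), Finset.sum_image]
  · refine Finset.sum_congr rfl fun P _ => ?_
    generalize hQ : (Fin.cons M0 P : Fin (r + 1) → (SiteG N r → ℕ)) = Q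
    have hQ0 : Q 0 = M0 := by rw [← hQ]; rfl
    simp only [wRow_eq, Nat.zero_add, eEnd]
    rw [Finset.prod_ite_zero]
    have hI := inSystem_Phi lam w1 w2 w3 w4 Q (by rw [hQ0, hM0])
    by_cases h : InSystem lam w1 w2 w3 w4 (PhiF (lB w2) Q)
    · rw [if_pos h, if_pos (fun i _ => (hI.1 h).1 i), if_pos (hI.1 h).2, mul_one]
      simp only [stateWeight, zB, ofNat_val]
      rfl
    · rw [if_neg h]
      split_ifs with h1 h2
      · exact absurd (hI.2 ⟨fun i => h1 i (Finset.mem_univ _), h2⟩) h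
      · simp
      · simp
      · simp
  · intro P _ P' _ h
    have h1 : (PhiF (lB w2) (Fin.cons M0 P : Fin (r + 1) → (SiteG N r → ℕ))).m =
      (PhiF (lB w2) (Fin.cons M0 P' : Fin (r + 1) → (SiteG N r → ℕ))).m := by
      exact congrArg Filling.m h
    funext i s
    have := congrFun (congrFun (congrFun h1 i.succ) s.1) s.2
    simpa [PhiF] using this
  · intro f hf
    rw [Function.mem_support] at hf
    have hf' : InSystem lam w1 w2 w3 w4 f := by
      by_contra h
      exact hf (if_neg h)
    obtain ⟨g1, g2, -, -, g5⟩ := hf'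
    rw [Finset.coe_image]
    have hQ : ∀ i j ab, (Fin.cons M0 (fun i s => f.m i.succ s.1 s.2) :
        Fin (r + 1) → (SiteG N r → ℕ)) i (j, ab) = f.m i j ab := by
      intro i j ab
      refine Fin.cases ?_ (fun i => ?_) i
      · rw [Fin.cons_zero, g2 j ab.1 ab.2]; rfl
      · rw [Fin.cons_succ]
    refine ⟨fun i s => f.m i.succ s.1 s.2, ?_, ?_⟩
    · rw [Finset.mem_coe, Fintype.mem_piFinset]
      intro i
      rw [mem_boxN]
      intro s
      have := box_of_state f g1 (fun j ab => by
        rw [g2 j ab.1 ab.2]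
        refine (Finset.card_le_univ _).trans ?_
        simp) (i.val + 1) (by omega) s.1 s.2
      rw [Nat.zero_add]
      exact this
    · refine Filling_ext _ _ ?_ ?_
      · funext i j ab
        exact hQ i j ab
      · funext i p
        have hp := p.2
        have := h_of_state f g1 (lB w2) _ hQ (fun i => by rw [g5 i, lB, ofNat_val]) i (N - p.val)
          (by omega)
        have e : N - (N - p.val) = p.val := by omega
        simp only [e] at this
        exact this.symm

end PartZ


section TwoRow
variable {A : Type*} [CommRing A] {r N : ℕ} [NeZero r] [NeZero N]

/-- two rows with fixed right boundary spins -/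
def TT (t zi zj : A) (Zt : (SiteG N r → ℕ) → A) (p q x y : Spin r) (M : SiteG N r → ℕ) : A :=
  twoOp t zi zj (rowSites r N N 0) (fun x' y' M' => if x' = p ∧ y' = q then Zt M' else 0) x y M

lemma twoOp_lin (t z1 z2 c1 c2 : A) (L : List (SiteG N r))
    (G1 G2 : Spin r → Spin r → (SiteG N r → ℕ) → A) (x y) (M) :
    twoOp t z1 z2 L (fun x y M => c1 * G1 x y M + c2 * G2 x y M) x y M
      = c1 * twoOp t z1 z2 L G1 x y M + c2 * twoOp t z1 z2 L G2 x y M := by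
  simp only [twoOp]
  rw [← rowOp_lin]
  congr 1
  funext x' M'
  exact rowOp_lin t z2 c1 c2 L (G1 x') (G2 x') y M'

lemma TT_ybe (t zi zj : A) (Zt : (SiteG N r → ℕ) → A) (p q e f : Fin r) (hpq : p < q)
    (hef : f < e) (M : SiteG N r → ℕ) :
    ((1 - t) * (zi ^ 2 * zj)) * TT t zi zj Zt (Sum.inl p) (Sum.inl q) (Sum.inr e) (Sum.inr f) M
    + ((zi - zj) * (zi * zj)) * TT t zi zj Zt (Sum.inl p) (Sum.inl q) (Sum.inr f) (Sum.inr e) M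
    = ((1 - t) * (zi * zj ^ 2)) * TT t zj zi Zt (Sum.inl p) (Sum.inl q) (Sum.inr e) (Sum.inr f) M
    + (t * ((zi - zj) * (zi * zj))) *
      TT t zj zi Zt (Sum.inl q) (Sum.inl p) (Sum.inr e) (Sum.inr f) M := by
  have h := YBE_rowSites (r := r) (N := N) t zi zj N 0 (by omega)
    (fun x' y' M' => if x' = Sum.inl p ∧ y' = Sum.inl q then Zt M' else 0) (Sum.inr e) (Sum.inr f) M
  have hne : (Sum.inr e : Spin r) ≠ Sum.inr f := fun h => hef.ne' (Sum.inr.inj h)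
  have hal : alphaG r 0 (r - 1) (Sum.inr e) (Sum.inr f) = 2 := by
    have h1 := e.2
    have h2 : f.val < e.val := hef
    simp only [alphaG, and_true]
    rw [if_pos]
    split_ifs <;> omega
  have hsw : swpG t (Sum.inr e : Spin r) (Sum.inr f) = 1 := by
    simp only [swpG]; rw [if_pos hef]
  rw [RG, if_neg hne, hal, hsw] at h
  have hR : (fun (u v : Spin r) (M' : SiteG N r → ℕ) => RG t zi zj (alphaG r 0 (r - 1))
      (fun u v => if u = Sum.inl p ∧ v = Sum.inl q then Zt M' else 0) u v)
      = fun u v M' => ((1 - t) * (zi * zj ^ 2)) *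
          (if u = Sum.inl p ∧ v = Sum.inl q then Zt M' else 0)
        + (t * ((zi - zj) * (zi * zj))) *
          (if u = Sum.inl q ∧ v = Sum.inl p then Zt M' else 0) := by
    funext u v M'
    have hpq' : (Sum.inl p : Spin r) ≠ Sum.inl q := fun h => hpq.ne (Sum.inl.inj h)
    by_cases h1 : u = Sum.inl p ∧ v = Sum.inl q
    · obtain ⟨rfl, rfl⟩ := h1
      have hal : alphaG r 0 (r - 1) (Sum.inl p) (Sum.inl q) = 1 := by
        have h2 : p.val < q.val := hpq
        simp only [alphaG]
        rw [if_neg]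
        omega
      rw [RG, if_neg hpq', hal]
      simp [hpq'.symm]
    · by_cases h2 : u = Sum.inl q ∧ v = Sum.inl p
      · obtain ⟨rfl, rfl⟩ := h2
        have hsw : swpG t (Sum.inl q : Spin r) (Sum.inl p) = t := by
          simp only [swpG]; rw [if_neg (not_lt.2 hpq.le)]
        rw [RG, if_neg hpq'.symm, hsw]
        simp [hpq'.symm]
        ring
      · have h3 : ¬ (v = Sum.inl p ∧ u = Sum.inl q) := fun h => h2 ⟨h.2, h.1⟩
        rw [RG]
        simp [h1, h2, h3]
  rw [hR, twoOp_lin] at h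
  simp only [TT]
  linear_combination h

lemma Zrec_two (t : A) (z : ℕ → A) (l rr : ℕ → Spin r) (n k : ℕ) (M : SiteG N r → ℕ) :
    Zrec t z l rr (n + 2) k M = TT t (z k) (z (k + 1)) (Zrec t z l rr n (k + 2))
      (rr k) (rr (k + 1)) (l k) (l (k + 1)) M := by
  rw [Zrec, TT, twoOp]
  congr 1
  funext x M'
  by_cases h : x = rr k
  · simp only [h, if_true, true_and]
    rfl
  · simp only [h, if_false, false_and, rowOp_zero]

lemma Zrec_congr (t : A) (z z' : ℕ → A) (l l' rr rr' : ℕ → Spin r) (n k : ℕ)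
    (hz : ∀ i, k ≤ i → i < k + n → z i = z' i) (hl : ∀ i, k ≤ i → i < k + n → l i = l' i)
    (hr : ∀ i, k ≤ i → i < k + n → rr i = rr' i) (M : SiteG N r → ℕ) :
    Zrec t z l rr n k M = Zrec t z' l' rr' n k M := by
  induction n generalizing k M with
  | zero => rfl
  | succ n ih =>
    rw [Zrec, Zrec, hz k le_rfl (by omega), hl k le_rfl (by omega), hr k le_rfl (by omega)]
    congr 1
    funext x M'
    rw [ih (k + 1) (fun i hi hj => hz i (by omega) (by omega)) (fun i hi hj => hl i (by omega) (by omega))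
      (fun i hi hj => hr i (by omega) (by omega))]

lemma Zrec_map {B : Type*} [CommRing B] (φ : A →+* B) (t : A) (z : ℕ → A) (l rr : ℕ → Spin r)
    (n k : ℕ) (M : SiteG N r → ℕ) :
    φ (Zrec t z l rr n k M) = Zrec (φ t) (fun k => φ (z k)) l rr n k M := by
  induction n generalizing k M with
  | zero => simp only [Zrec, apply_ite φ, map_one, map_zero]
  | succ n ih =>
    rw [Zrec, Zrec, rowOp_map]
    congr 1
    funext x M'
    rw [apply_ite φ, ih, map_zero]

lemma lin_step (t z c1 c2 c3 c4 : A) (L : List (SiteG N r)) (p x : Spin r)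
    (Z1 Z2 Z3 Z4 : (SiteG N r → ℕ) → A)
    (h : ∀ M, c1 * Z1 M + c2 * Z2 M = c3 * Z3 M + c4 * Z4 M) (M : SiteG N r → ℕ) :
    c1 * rowOp t z L (fun y M => if y = p then Z1 M else 0) x M
      + c2 * rowOp t z L (fun y M => if y = p then Z2 M else 0) x M
    = c3 * rowOp t z L (fun y M => if y = p then Z3 M else 0) x M
      + c4 * rowOp t z L (fun y M => if y = p then Z4 M else 0) x M := by
  rw [← rowOp_lin, ← rowOp_lin]
  congr 1
  funext y M
  split_ifs
  · exact h M
  · simp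

theorem Zrec_exchange (t : A) (z z' : ℕ → A) (l l' rr rr' : ℕ → Spin r) (n a : ℕ)
    (p q e f : Fin r) (hpq : p < q) (hef : f < e)
    (hz : ∀ i, i < a + 2 + n → i ≠ a → i ≠ a + 1 → z i = z' i) (hza : z' a = z (a + 1)) (hzb : z' (a + 1) = z a)
    (hl : ∀ i, i < a + 2 + n → i ≠ a → i ≠ a + 1 → l i = l' i) (hla : l a = Sum.inr e) (hlb : l (a + 1) = Sum.inr f)
    (hla' : l' a = Sum.inr f) (hlb' : l' (a + 1) = Sum.inr e)
    (hr : ∀ i, i < a + 2 + n → i ≠ a → i ≠ a + 1 → rr i = rr' i) (hra : rr a = Sum.inl p)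
    (hrb : rr (a + 1) = Sum.inl q) (hra' : rr' a = Sum.inl q) (hrb' : rr' (a + 1) = Sum.inl p)
    (d k : ℕ) (hd : k + d = a) (M : SiteG N r → ℕ) :
    ((1 - t) * (z a ^ 2 * z (a + 1))) * Zrec t z l rr (n + 2 + d) k M
    + ((z a - z (a + 1)) * (z a * z (a + 1))) * Zrec t z l' rr (n + 2 + d) k M
    = ((1 - t) * (z a * z (a + 1) ^ 2)) * Zrec t z' l rr (n + 2 + d) k M
    + (t * ((z a - z (a + 1)) * (z a * z (a + 1)))) * Zrec t z' l rr' (n + 2 + d) k M := by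
  induction d generalizing k M with
  | zero =>
    have hk : k = a := by omega
    subst hk
    rw [Nat.add_zero, Zrec_two, Zrec_two, Zrec_two, Zrec_two, hza, hzb, hla, hlb, hla', hlb', hra,
      hrb, hra', hrb']
    have e2 : Zrec t z l' rr n (k + 2) = (Zrec t z l rr n (k + 2) : (SiteG N r → ℕ) → A) := by
      funext M
      exact Zrec_congr _ _ _ _ _ _ _ _ _ (fun _ _ _ => rfl)
        (fun i hi hj => (hl i (by omega) (by omega) (by omega)).symm) (fun _ _ _ => rfl) M
    have e3 : Zrec t z' l rr n (k + 2) = (Zrec t z l rr n (k + 2) : (SiteG N r → ℕ) → A) := by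
      funext M
      exact Zrec_congr _ _ _ _ _ _ _ _ _ (fun i hi hj => (hz i (by omega) (by omega) (by omega)).symm)
        (fun _ _ _ => rfl) (fun _ _ _ => rfl) M
    have e4 : Zrec t z' l rr' n (k + 2) = (Zrec t z l rr n (k + 2) : (SiteG N r → ℕ) → A) := by
      funext M
      exact Zrec_congr _ _ _ _ _ _ _ _ _ (fun i hi hj => (hz i (by omega) (by omega) (by omega)).symm)
        (fun _ _ _ => rfl) (fun i hi hj => (hr i (by omega) (by omega) (by omega)).symm) M
    rw [e2, e3, e4]
    exact TT_ybe t _ _ _ p q e f hpq hef M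
  | succ d ih =>
    have h1 := ih (k + 1) (by omega)
    have := lin_step t (z k) _ _ _ _ (rowSites r N N 0) (rr k) (l k) _ _ _ _ h1 M
    rw [← Nat.add_assoc, Zrec, Zrec, Zrec, Zrec, ← hz k (by omega) (by omega) (by omega),
      ← hl k (by omega) (by omega) (by omega), ← hr k (by omega) (by omega) (by omega)]
    exact this

end TwoRow

section Final
variable {r N : ℕ}

lemma swap_adj_lt (a b x y : Fin r) (hab : a.val + 1 = b.val) (hxy : x < y)
    (h : ¬ (x = a ∧ y = b)) : Equiv.swap a b x < Equiv.swap a b y := by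
  simp only [Equiv.swap_apply_def, Fin.lt_def, Fin.ext_iff] at *
  split_ifs <;> omega

lemma invCount_le (a b : Fin r) (hab : a.val + 1 = b.val) (w : Equiv.Perm (Fin r))
    (h : w⁻¹ a < w⁻¹ b) : invCount w ≤ invCount (Equiv.swap a b * w) := by
  refine Finset.card_le_card ?_
  intro p hp
  simp only [Finset.mem_filter, Finset.mem_univ, true_and] at hp ⊢
  refine ⟨hp.1, ?_⟩
  rw [Equiv.Perm.mul_apply, Equiv.Perm.mul_apply]
  refine swap_adj_lt a b _ _ hab hp.2 ?_
  rintro ⟨h1, h2⟩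
  rw [← h1, ← h2, Equiv.Perm.inv_def, Equiv.symm_apply_apply, Equiv.symm_apply_apply] at h
  exact absurd hp.1 (not_lt.2 h.le)

lemma swap_mul_inv (a b x : Fin r) (w : Equiv.Perm (Fin r)) :
    (Equiv.swap a b * w)⁻¹ x = w⁻¹ (Equiv.swap a b x) := by
  rw [mul_inv_rev, Equiv.Perm.mul_apply, Equiv.swap_inv]

lemma lt_of_inv_gt (a b : Fin r) (hab : a.val + 1 = b.val) (w : Equiv.Perm (Fin r))
    (h : invCount (Equiv.swap a b * w) > invCount w) : w⁻¹ a < w⁻¹ b := by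
  by_contra h1
  have hne : a ≠ b := fun h => by rw [h] at hab; omega
  have h2 : w⁻¹ b < w⁻¹ a := lt_of_le_of_ne (not_lt.1 h1) (fun h => hne (w⁻¹.injective h).symm)
  have := invCount_le a b hab (Equiv.swap a b * w) (by
    rw [swap_mul_inv, swap_mul_inv, Equiv.swap_apply_left, Equiv.swap_apply_right]; exact h2)
  rw [← mul_assoc, Equiv.swap_mul_self, one_mul] at this
  omega

lemma lt_of_inv_lt (a b : Fin r) (hab : a.val + 1 = b.val) (w : Equiv.Perm (Fin r))
    (h : invCount (Equiv.swap a b * w) < invCount w) : w⁻¹ b < w⁻¹ a := by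
  by_contra h1
  have hne : a ≠ b := fun h => by rw [h] at hab; omega
  have h2 : w⁻¹ a < w⁻¹ b := lt_of_le_of_ne (not_lt.1 h1) (fun h => hne (w⁻¹.injective h))
  have := invCount_le a b hab w h2
  omega

lemma sigmaF_zF (a b k : Fin r) : sigmaF a b (zF k) = zF (Equiv.swap a b k) := by
  simp [sigmaF, zF]

lemma sigmaF_tF (a b : Fin r) : sigmaF a b (tF r) = tF r := by
  simp [sigmaF, tF]

lemma toFF_tP : toFF r (tP r) = tF r := by
  simp [toFF, tP]

lemma toFF_zP (i : Fin r) : toFF r (zP i) = zF i := by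
  simp [toFF, zP]

lemma zF_inj : Function.Injective (zF : Fin r → FFld r) := by
  intro i j h
  have := IsFractionRing.injective (MvPolynomial (Fin r) Kt) (FFld r) h
  exact MvPolynomial.X_injective this

lemma zF_ne_zero (i : Fin r) : (zF i : FFld r) ≠ 0 := by
  intro h
  have h' : algebraMap (MvPolynomial (Fin r) Kt) (FFld r) (MvPolynomial.X i) = 0 := h
  rw [map_eq_zero_iff _ (IsFractionRing.injective (MvPolynomial (Fin r) Kt) (FFld r))] at h'
  exact MvPolynomial.X_ne_zero i h'

end Final

/-- if ℓ(s w₁) > ℓ(w₁) and ℓ(s w₂) < ℓ(w₂) then (1-t)·D⁽²⁾(Z(w₁,w₂)) = t·σ(Z(s w₁, w₂)) − Z(w₁, s w₂). -/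
theorem stmt11 (r N : ℕ) (hr : 2 ≤ r) (hN : 1 ≤ N)
    (lam : Fin r → ℕ)
    (hpart : ∀ i j : Fin r, i ≤ j → lam j ≤ lam i)
    (hlam1 : lam ⟨0, by omega⟩ ≤ N - 1)
    (w3 w4 : Equiv.Perm (Fin r))
    (w1 w2 : Equiv.Perm (Fin r))
    (i : ℕ) (h1 : 1 ≤ i) (h2 : i ≤ r - 1) :
    let a : Fin r := ⟨i - 1, by omega⟩
    let b : Fin r := ⟨i, by omega⟩
    let s : Equiv.Perm (Fin r) := Equiv.swap a b
    let Z : Equiv.Perm (Fin r) → Equiv.Perm (Fin r) → FFld r := fun u v =>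
      toFF r (partitionZ r N lam u v w3 w4)
    invCount (s * w1) > invCount w1 →
    invCount (s * w2) < invCount w2 →
    (1 - tF r) * DF2 a b (Z w1 w2) = tF r * sigmaF a b (Z (s * w1) w2) - Z w1 (s * w2) := by
  intro a b s Z hw1 hw2
  have : NeZero r := ⟨by omega⟩
  have : NeZero N := ⟨by omega⟩
  have hab : a.val + 1 = b.val := by show i - 1 + 1 = i; omega
  have hpq := lt_of_inv_gt a b hab w1 hw1
  have hef := lt_of_inv_lt a b hab w2 hw2
  have hne : a ≠ b := fun h => by rw [h] at hab; omega
  have hZ : ∀ u v, Z u v = Zrec (tF r) (fun k => zF (Fin.ofNat r k)) (lB v) (rB u) r 0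
      (topM N lam w3 w4) := by
    intro u v
    show toFF r (partitionZ r N lam u v w3 w4) = _
    rw [partitionZ_eq, Zrec_map, toFF_tP]
    simp only [zB, toFF_zP]
  have hS : ∀ u v, sigmaF a b (Z u v) = Zrec (tF r) (fun k => zF (s (Fin.ofNat r k))) (lB v) (rB u)
      r 0 (topM N lam w3 w4) := by
    intro u v
    have := Zrec_map (sigmaF a b : FFld r ≃+* FFld r).toRingHom (tF r)
      (fun k => zF (Fin.ofNat r k)) (lB v) (rB u) r 0 (topM N lam w3 w4)
    rw [hZ]
    simp only [RingEquiv.toRingHom_eq_coe, RingHom.coe_coe, sigmaF_tF, sigmaF_zF] at this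
    exact this
  have oa : Fin.ofNat r a.val = a := ofNat_val a
  have ob : Fin.ofNat r (a.val + 1) = b := by rw [hab]; exact ofNat_val b
  have hmod : ∀ k, k < a.val + 2 + (r - 2 - a.val) → k ≠ a.val → k ≠ a.val + 1 →
      s (Fin.ofNat r k) = Fin.ofNat r k := by
    intro k hk hka hkb
    have ha := a.2
    have hk' : k < r := by omega
    refine Equiv.swap_apply_of_ne_of_ne ?_ ?_
    · intro h
      have := congrArg Fin.val h
      simp only [Fin.ofNat, Nat.mod_eq_of_lt hk'] at this
      omega
    · intro h
      have := congrArg Fin.val h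
      simp only [Fin.ofNat, Nat.mod_eq_of_lt hk'] at this
      omega
  have hsa : s a = b := Equiv.swap_apply_left a b
  have hsb : s b = a := Equiv.swap_apply_right a b
  have key := Zrec_exchange (tF r) (fun k => zF (Fin.ofNat r k)) (fun k => zF (s (Fin.ofNat r k)))
    (lB w2) (lB (s * w2)) (rB w1) (rB (s * w1)) (r - 2 - a.val) a.val (w1⁻¹ a) (w1⁻¹ b) (w2⁻¹ a)
    (w2⁻¹ b) hpq hef
    (fun k hk hka hkb => by simp only [hmod k hk hka hkb])
    (by simp only [oa, ob, hsa]) (by simp only [oa, ob, hsb])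
    (fun k hk hka hkb => by rw [lB, lB, swap_mul_inv, hmod k hk hka hkb])
    (by rw [lB, oa]) (by rw [lB, ob])
    (by rw [lB, oa, swap_mul_inv]; rw [Equiv.swap_apply_left]) (by rw [lB, ob, swap_mul_inv]; rw [Equiv.swap_apply_right])
    (fun k hk hka hkb => by rw [rB, rB, swap_mul_inv, hmod k hk hka hkb])
    (by rw [rB, oa]) (by rw [rB, ob])
    (by rw [rB, oa, swap_mul_inv]; rw [Equiv.swap_apply_left]) (by rw [rB, ob, swap_mul_inv]; rw [Equiv.swap_apply_right])
    a.val 0 (by omega) (topM N lam w3 w4)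
  have hcount : r - 2 - a.val + 2 + a.val = r := by
    have hb := b.2
    omega
  rw [hcount, ← hZ, ← hZ, ← hS, ← hS] at key
  simp only [oa, ob] at key
  have hza := zF_ne_zero a
  have hzb := zF_ne_zero b
  have hd : (zF a - zF b : FFld r) ≠ 0 := sub_ne_zero.2 fun h => hne (zF_inj h)
  have key2 : (1 - tF r) * zF a * Z w1 w2 + (zF a - zF b) * Z w1 (s * w2)
      = (1 - tF r) * zF b * sigmaF a b (Z w1 w2)
        + tF r * (zF a - zF b) * sigmaF a b (Z (s * w1) w2) := by
    refine mul_left_cancel₀ (mul_ne_zero hza hzb) ?_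
    linear_combination key
  rw [DF2]
  refine mul_left_cancel₀ hd ?_
  have hi : (zF a - zF b) * (zF a - zF b : FFld r)⁻¹ = 1 := mul_inv_cancel₀ hd
  linear_combination key2 + (1 - tF r) * (zF a * Z w1 w2 - zF b * sigmaF a b (Z w1 w2)) * hi
end
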